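/- Under Assumptions A1–A2, the system y_{t+1} = θ·f(y_t) + u_t + w_{t+1} is globally stabilizable if: (i) there exist a ≥ 4 and constants γ₁, γ₂ > 0 such that |f(x)| ≤ γ₁ + γ₂·|x|^a for all x ∈ ℝ; and (ii) there exist numbers b < (1 + x_min)² and L > 0 such that liminf_{l→+∞} (ℓ(S_b^L ∩ [−l, l])/l)·log(log l) > 0, where x_min = ((a−2) − √((a−2)² − 4))/2 denotes the smallest real solution of the equation x² − (a−2)x + 1 = 0. -/

import Mathlib

open MeasureTheory ProbabilityTheory Filter

-- part A
noncomputable section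
namespace Stab

/-- The standard Gaussian. -/
abbrev gam : Measure ℝ := gaussianReal 0 1

lemma rot_inv (c s : ℝ) (h : c ^ 2 + s ^ 2 = 1) :
    MeasurePreserving (fun p : ℝ × ℝ => (c * p.1 + s * p.2, s * p.1 - c * p.2))
      (gam.prod gam) (gam.prod gam) := by
  refine ⟨by fun_prop, ?_⟩
  obtain ⟨φ, hc, hs⟩ : ∃ φ : ℝ, Real.cos φ = c ∧ Real.sin φ = s := by
    have hn : ‖(⟨c, s⟩ : ℂ)‖ = 1 := by
      rw [Complex.norm_def, Complex.normSq_mk, ← sq, ← sq, h, Real.sqrt_one]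
    have h0 : (⟨c, s⟩ : ℂ) ≠ 0 := by
      intro h0; rw [h0] at hn; simp at hn
    refine ⟨Complex.arg ⟨c, s⟩, ?_, ?_⟩
    · rw [Complex.cos_arg h0, hn]; simp
    · rw [Complex.sin_arg, hn]; simp
  have h1 : (gam.prod gam).map (ContinuousLinearMap.rotation φ) = gam.prod gam := by
    apply IsGaussian.map_rotation_eq_self_of_forall_strongDual_eq_zero
    intro L
    rw [integral_continuousLinearMap_gaussianReal]; simp
  have h2 : MeasurePreserving (Prod.map id (fun x : ℝ => -x)) (gam.prod gam) (gam.prod gam) := by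
    apply MeasurePreserving.prod (MeasurePreserving.id _)
    refine ⟨by fun_prop, ?_⟩
    have := gaussianReal_map_neg (μ := 0) (v := 1)
    simpa using this
  have h3 : MeasurePreserving (ContinuousLinearMap.rotation φ) (gam.prod gam) (gam.prod gam) :=
    ⟨by fun_prop, h1⟩
  have h4 := (h2.comp h3).map_eq
  rw [← h4, ← hc, ← hs]
  rw [h4]
  nth_rewrite 2 [← h4]
  congr 1
  ext p
  · simp [ContinuousLinearMap.rotation_apply]
  · simp [ContinuousLinearMap.rotation_apply]; ring

lemma rot_fiber {X : Type*} [MeasurableSpace X] (ν : Measure X) [IsProbabilityMeasure ν]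
    (c s : X → ℝ) (hc : Measurable c) (hs : Measurable s) (h : ∀ x, c x ^ 2 + s x ^ 2 = 1) :
    MeasurePreserving (fun q : X × (ℝ × ℝ) =>
      (q.1, (c q.1 * q.2.1 + s q.1 * q.2.2, s q.1 * q.2.1 - c q.1 * q.2.2)))
      (ν.prod (gam.prod gam)) (ν.prod (gam.prod gam)) := by
  refine MeasurePreserving.skew_product (f := id)
    (g := fun x (p : ℝ × ℝ) => (c x * p.1 + s x * p.2, s x * p.1 - c x * p.2)) (MeasurePreserving.id _) ?_ ?_
  · simp only [Function.uncurry_def]; fun_prop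
  · exact Eventually.of_forall fun x => (rot_inv _ _ (h x)).map_eq

/-- Normalized information. -/
def RR (F : ℝ → ℝ) (z : ℕ → ℝ) (t : ℕ) : ℝ := 1 + ∑ i ∈ Finset.range t, F (z i) ^ 2

lemma RR_zero (F z) : RR F z 0 = 1 := by simp [RR]
lemma RR_succ (F z t) : RR F z (t + 1) = RR F z t + F (z t) ^ 2 := by
  simp [RR, Finset.sum_range_succ, add_assoc]
lemma RR_ge (F z t) : 1 ≤ RR F z t := by
  unfold RR; have := Finset.sum_nonneg (s := Finset.range t) (f := fun i => F (z i) ^ 2)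
    (fun i _ => sq_nonneg _)
  linarith

/-- Parameter estimate. -/
def est (F : ℝ → ℝ) (θ₀ p : ℝ) (z : ℕ → ℝ) (t : ℕ) : ℝ :=
  θ₀ + p * ∑ i ∈ Finset.range t, F (z i) * z (i + 1) / RR F z (i + 1)

/-- Extension of finite history. -/
def ext (t : ℕ) (h : Fin (t + 1) → ℝ) (i : ℕ) : ℝ := if hi : i < t + 1 then h ⟨i, hi⟩ else 0

lemma RR_congr (F) {z z' : ℕ → ℝ} (t : ℕ) (h : ∀ i < t, z i = z' i) : RR F z t = RR F z' t := by
  unfold RR; congr 1; apply Finset.sum_congr rfl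
  intro i hi; rw [h i (Finset.mem_range.1 hi)]

lemma est_congr (F θ₀ p) {z z' : ℕ → ℝ} (t : ℕ) (h : ∀ i ≤ t, z i = z' i) :
    est F θ₀ p z t = est F θ₀ p z' t := by
  unfold est; congr 2; apply Finset.sum_congr rfl
  intro i hi
  have hi := Finset.mem_range.1 hi
  rw [h i hi.le, h (i+1) hi, RR_congr F (i+1) (fun j hj => h j (by omega))]

/-- The controller. -/
def ctrl (f F : ℝ → ℝ) (θ₀ p : ℝ) (t : ℕ) (h : Fin (t + 1) → ℝ) : ℝ :=
  - est F θ₀ p (ext t h) t * f (ext t h t)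

lemma meas_ext (t i : ℕ) : Measurable (fun h : Fin (t + 1) → ℝ => ext t h i) := by
  unfold ext; split_ifs <;> fun_prop

lemma meas_RR {Ω : Type*} {m : MeasurableSpace Ω} {F : ℝ → ℝ} (hF : Measurable F)
    {y : ℕ → Ω → ℝ} (t : ℕ) (hy : ∀ i < t, Measurable (y i)) :
    Measurable (fun ω => RR F (fun i => y i ω) t) := by
  unfold RR
  apply Measurable.const_add
  apply Finset.measurable_fun_sum
  intro i hi
  exact (hF.comp (hy i (Finset.mem_range.1 hi))).pow_const 2

lemma meas_est {Ω : Type*} {m : MeasurableSpace Ω} {F : ℝ → ℝ} (hF : Measurable F) (θ₀ p : ℝ)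
    {y : ℕ → Ω → ℝ} (t : ℕ) (hy : ∀ i ≤ t, Measurable (y i)) :
    Measurable (fun ω => est F θ₀ p (fun i => y i ω) t) := by
  unfold est
  apply Measurable.const_add
  apply Measurable.const_mul
  apply Finset.measurable_fun_sum
  intro i hi
  have hi := Finset.mem_range.1 hi
  exact ((hF.comp (hy i hi.le)).mul (hy _ hi)).div (meas_RR hF _ (fun j hj => hy j (by omega)))

lemma meas_ctrl {f F : ℝ → ℝ} (hf : Measurable f) (hF : Measurable F) (θ₀ p : ℝ) (t : ℕ) :
    Measurable (ctrl f F θ₀ p t) := by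
  unfold ctrl
  have := meas_est (Ω := Fin (t+1) → ℝ) hF θ₀ p (y := fun i h => ext t h i) t
    (fun i _ => meas_ext t i)
  exact this.neg.mul (hf.comp (meas_ext t t))

lemma ext_hist (t : ℕ) (z : ℕ → ℝ) (i : ℕ) (hi : i ≤ t) :
    ext t (fun j : Fin (t + 1) => z j) i = z i := by
  simp [ext, Nat.lt_succ_of_le hi]

lemma ctrl_hist (f F : ℝ → ℝ) (θ₀ p : ℝ) (t : ℕ) (z : ℕ → ℝ) :
    ctrl f F θ₀ p t (fun j : Fin (t + 1) => z j) = - est F θ₀ p z t * f (z t) := by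
  unfold ctrl
  rw [ext_hist t z t le_rfl, est_congr F θ₀ p t (fun i hi => ext_hist t z i hi)]

end Stab

end

-- part A2
noncomputable section
namespace Stab

section
variable {Ω : Type*} [MeasurableSpace Ω] {P : Measure Ω} [IsProbabilityMeasure P]

lemma indep_assoc {α β γ : Type*} [MeasurableSpace α] [MeasurableSpace β] [MeasurableSpace γ]
    {X : Ω → α} {Y : Ω → β} {Z : Ω → γ} (hX : Measurable X) (hY : Measurable Y) (hZ : Measurable Z)
    (h1 : IndepFun X (fun ω => (Y ω, Z ω)) P) (h2 : IndepFun Y Z P) :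
    IndepFun (fun ω => (X ω, Y ω)) Z P := by
  have hXY : IndepFun X Y P := h1.comp (φ := id) (ψ := Prod.fst) measurable_id measurable_fst
  rw [indepFun_iff_map_prod_eq_prod_map_map (by fun_prop) (by fun_prop)] at h1 h2 hXY ⊢
  rw [hXY]
  rw [h2] at h1
  have := Measure.isProbabilityMeasure_map (μ := P) hX.aemeasurable
  have := Measure.isProbabilityMeasure_map (μ := P) hY.aemeasurable
  have := Measure.isProbabilityMeasure_map (μ := P) hZ.aemeasurable
  have h3 := (measurePreserving_prodAssoc (P.map X) (P.map Y) (P.map Z)).symm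
  rw [← h3.map_eq, ← h1, Measure.map_map (by fun_prop) (by fun_prop)]
  rfl

lemma indep_past (θ : Ω → ℝ) (hθm : Measurable θ)
    (w : ℕ → Ω → ℝ) (hwm : ∀ t, Measurable (w t))
    (hw_indep : iIndepFun (fun t : ℕ => w (t + 1)) P)
    (hθw : IndepFun θ (fun ω (t : ℕ) => w (t + 1) ω) P) (t : ℕ) :
    IndepFun (fun ω => (θ ω, fun i : Fin t => w (i + 1) ω)) (w (t + 1)) P := by
  apply indep_assoc hθm (by fun_prop) (hwm _)
  · exact hθw.comp (φ := id) (ψ := fun v : ℕ → ℝ => ((fun i : Fin t => v i), v t))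
      measurable_id (by fun_prop)
  · have := hw_indep.indepFun_finset (Finset.range t) {t} (by simp) (fun i => hwm _)
    have h1 : Measurable (fun v : ({t} : Finset ℕ) → ℝ => v ⟨t, by simp⟩) :=
      measurable_pi_apply _
    have := this.comp (φ := fun v : (Finset.range t) → ℝ =>
        (fun i : Fin t => v ⟨i, Finset.mem_range.2 i.2⟩))
      (ψ := fun v : ({t} : Finset ℕ) → ℝ => v ⟨t, by simp⟩) (by fun_prop) h1
    exact this

lemma rot_joint {X : Type*} [MeasurableSpace X] (h : Ω → X) (hh : Measurable h)
    (ξ : Ω → ℝ) (hξ : Measurable ξ) (w : Ω → ℝ) (hw : Measurable w)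
    (i1 : IndepFun h ξ P) (i2 : P.map ξ = gam) (i3 : IndepFun (fun ω => (h ω, ξ ω)) w P)
    (i4 : P.map w = gam) {c s : X → ℝ} (hc : Measurable c) (hs : Measurable s)
    (hcs : ∀ x, c x ^ 2 + s x ^ 2 = 1) {e ξ' : Ω → ℝ}
    (he : ∀ ω, e ω = c (h ω) * ξ ω + s (h ω) * w ω)
    (hξ' : ∀ ω, ξ' ω = s (h ω) * ξ ω - c (h ω) * w ω) :
    P.map e = gam ∧ IndepFun h e P ∧ P.map ξ' = gam ∧ IndepFun (fun ω => (h ω, e ω)) ξ' P := by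
  have hP := Measure.isProbabilityMeasure_map (μ := P) hh.aemeasurable
  have hem : Measurable e := by
    rw [funext he]; exact ((hc.comp hh).mul hξ).add ((hs.comp hh).mul hw)
  have hξm : Measurable ξ' := by
    rw [funext hξ']; exact ((hs.comp hh).mul hξ).sub ((hc.comp hh).mul hw)
  rw [indepFun_iff_map_prod_eq_prod_map_map (by fun_prop) (by fun_prop)] at i1 i3
  rw [i1, i2, i4] at i3
  have h5 : P.map (fun ω => (h ω, (ξ ω, w ω))) = (P.map h).prod (gam.prod gam) := by
    rw [← (measurePreserving_prodAssoc (P.map h) gam gam).map_eq, ← i3,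
      Measure.map_map (by fun_prop) (by fun_prop)]
    rfl
  have h6 : P.map (fun ω => (h ω, (e ω, ξ' ω))) = (P.map h).prod (gam.prod gam) := by
    have := rot_fiber (P.map h) c s hc hs hcs
    rw [← this.map_eq, ← h5, Measure.map_map this.measurable (by fun_prop)]
    congr 1
    funext ω
    simp [he, hξ']
  have h7 : P.map (fun ω => ((h ω, e ω), ξ' ω)) = ((P.map h).prod gam).prod gam := by
    have := (measurePreserving_prodAssoc (P.map h) gam gam).symm
    rw [← this.map_eq, ← h6, Measure.map_map (by fun_prop) (by fun_prop)]
    rfl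
  have h8 : P.map (fun ω => (h ω, e ω)) = (P.map h).prod gam := by
    have := congrArg (Measure.map Prod.fst) h7
    rw [Measure.map_map (by fun_prop) (by fun_prop), Measure.map_fst_prod] at this
    simpa [Function.comp_def] using this
  have h9 : P.map ξ' = gam := by
    have := congrArg (Measure.map Prod.snd) h7
    rw [Measure.map_map (by fun_prop) (by fun_prop), Measure.map_snd_prod] at this
    simpa [Function.comp_def] using this
  have h10 : P.map e = gam := by
    have := congrArg (Measure.map Prod.snd) h8
    rw [Measure.map_map (by fun_prop) (by fun_prop), Measure.map_snd_prod] at this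
    simpa [Function.comp_def] using this
  refine ⟨h10, ?_, h9, ?_⟩
  · rw [indepFun_iff_map_prod_eq_prod_map_map (by fun_prop) (by fun_prop), h8, h10]
  · rw [indepFun_iff_map_prod_eq_prod_map_map (by fun_prop) (by fun_prop), h7, h8, h9]

lemma innovations (f F : ℝ → ℝ) (hf : Measurable f)
    (θ : Ω → ℝ) (hθm : Measurable θ)
    (w : ℕ → Ω → ℝ) (hwm : ∀ t, Measurable (w t))
    (θ₀ p : ℝ) (hp : 0 < p) (hFf : ∀ x, F x = p * f x) (hF : Measurable F)
    (hw_gauss : ∀ t : ℕ, Measure.map (w (t + 1)) P = gaussianReal 0 1)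
    (hw_indep : iIndepFun (fun t : ℕ => w (t + 1)) P)
    (hθ_gauss : Measure.map (fun ω => (θ ω - θ₀) / p) P = gaussianReal 0 1)
    (hθw : IndepFun θ (fun ω (t : ℕ) => w (t + 1) ω) P)
    (y₀ : ℝ) (y : ℕ → Ω → ℝ) (hy0 : ∀ ω, y 0 ω = y₀)
    (hy : ∀ t ω, y (t + 1) ω =
          θ ω * f (y t ω) + ctrl f F θ₀ p t (fun i => y i ω) + w (t + 1) ω) :
    ∃ e : ℕ → Ω → ℝ, (∀ t, Measurable (e t)) ∧ (∀ t, Measurable (y t)) ∧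
      (∀ t, Measure.map (e (t + 1)) P = gam) ∧
      (∀ t, IndepFun (fun ω (i : Fin (t + 1)) => y i ω) (e (t + 1)) P) ∧
      ∀ t ω, y (t + 1) ω =
        √(RR F (fun i => y i ω) (t + 1) / RR F (fun i => y i ω) t) * e (t + 1) ω := by
  -- measurability with respect to the past
  have hmeas : ∀ (t : ℕ) (m : MeasurableSpace Ω), Measurable[m] θ →
      (∀ i < t, Measurable[m] (w (i + 1))) → ∀ s ≤ t, Measurable[m] (y s) := by
    intro t m h1 h2 s
    induction s using Nat.strong_induction_on with
    | _ s ih =>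
      intro hs
      rcases s with _ | s
      · have : y 0 = fun _ => y₀ := funext hy0
        rw [this]; exact measurable_const
      · have : y (s + 1) = fun ω => θ ω * f (y s ω) + ctrl f F θ₀ p s (fun i => y i ω)
            + w (s + 1) ω := funext (hy s)
        rw [this]
        refine Measurable.add (Measurable.add (h1.mul (hf.comp (ih s (by omega) (by omega)))) ?_)
          (h2 s (by omega))
        refine (meas_ctrl hf hF θ₀ p s).comp (measurable_pi_lambda _ ?_)
        intro i
        exact ih i (by omega) (by omega)
  have hym : ∀ t, Measurable (y t) := fun t => hmeas t _ hθm (fun i _ => hwm _) t le_rfl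
  set R : ℕ → Ω → ℝ := fun t ω => RR F (fun i => y i ω) t with hR
  have hRge : ∀ t ω, 1 ≤ R t ω := fun t ω => RR_ge _ _ _
  have hRs : ∀ t ω, R (t + 1) ω = R t ω + F (y t ω) ^ 2 := fun t ω => RR_succ _ _ _
  set ξ : ℕ → Ω → ℝ := fun t ω => √(R t ω) * ((θ ω - est F θ₀ p (fun i => y i ω) t) / p) with hξ
  have hyξ : ∀ t ω, y (t + 1) ω = F (y t ω) * ((θ ω - est F θ₀ p (fun i => y i ω) t) / p)
      + w (t + 1) ω := by
    intro t ω
    rw [hy, ctrl_hist f F θ₀ p t (fun i => y i ω), hFf]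
    field_simp
    ring
  have hest : ∀ t ω, est F θ₀ p (fun i => y i ω) (t + 1) = est F θ₀ p (fun i => y i ω) t
      + p * (F (y t ω) * y (t + 1) ω / R (t + 1) ω) := by
    intro t ω
    simp only [est, Finset.sum_range_succ, hR]; ring
  set c : ℕ → Ω → ℝ := fun t ω => F (y t ω) / √(R (t + 1) ω) with hc
  set s : ℕ → Ω → ℝ := fun t ω => √(R t ω) / √(R (t + 1) ω) with hs
  have hcs : ∀ t ω, c t ω ^ 2 + s t ω ^ 2 = 1 := by
    intro t ω
    have h1 := hRge t ω
    have h2 := hRge (t + 1) ω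
    simp only [hc, hs, div_pow]
    rw [Real.sq_sqrt (by linarith), Real.sq_sqrt (by linarith), ← add_div, hRs,
      add_comm, div_self]
    rw [← hRs]; linarith
  set e : ℕ → Ω → ℝ := fun t ω => match t with
    | 0 => 0
    | t + 1 => c t ω * ξ t ω + s t ω * w (t + 1) ω with he
  have hRm : ∀ t, Measurable (R t) := fun t => meas_RR hF t (fun i _ => hym i)
  have hcm : ∀ t, Measurable (c t) := fun t => (hF.comp (hym t)).div (hRm _).sqrt
  have hsm : ∀ t, Measurable (s t) := fun t => (hRm _).sqrt.div (hRm _).sqrt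
  have hξm : ∀ t, Measurable (ξ t) := fun t => (hRm t).sqrt.mul
    ((hθm.sub (meas_est hF θ₀ p t (fun i _ => hym i))).div_const _)
  have hem : ∀ t, Measurable (e t) := by
    intro t
    rcases t with _ | t
    · exact measurable_const
    · exact ((hcm t).mul (hξm t)).add ((hsm t).mul (hwm _))
  have hye : ∀ t ω, y (t + 1) ω = √(R (t + 1) ω / R t ω) * e (t + 1) ω := by
    intro t ω
    have h1 := hRge t ω
    have h2 := hRge (t + 1) ω
    have h1' : 0 < √(R t ω) := Real.sqrt_pos.2 (by linarith)
    have h2' : 0 < √(R (t + 1) ω) := Real.sqrt_pos.2 (by linarith)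
    rw [hyξ, Real.sqrt_div (by linarith)]
    simp only [he, hc, hs, hξ]
    field_simp
  have hξs : ∀ t ω, ξ (t + 1) ω = s t ω * ξ t ω - c t ω * w (t + 1) ω := by
    intro t ω
    have h1 := hRge t ω
    have h2 := hRge (t + 1) ω
    have h1' : 0 < √(R t ω) := Real.sqrt_pos.2 (by linarith)
    have h2' : 0 < √(R (t + 1) ω) := Real.sqrt_pos.2 (by linarith)
    have h1'' : √(R t ω) ^ 2 = R t ω := Real.sq_sqrt (by linarith)
    have h2'' : √(R (t + 1) ω) ^ 2 = R (t + 1) ω := Real.sq_sqrt (by linarith)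
    have h3 := hRs t ω
    have h4 := hyξ t ω
    simp only [hξ, hest, hc, hs]
    generalize est F θ₀ p (fun i => y i ω) t = E at *
    rw [h4]
    generalize √(R t ω) = r at *
    generalize √(R (t + 1) ω) = r' at *
    rw [← h2''] at h3 ⊢
    rw [← h1''] at h3
    field_simp
    have : r ^ 2 = r' ^ 2 - F (y t ω) ^ 2 := by linarith
    rw [this]; ring
  -- the joint law
  have hjoint : ∀ t, IndepFun (fun ω (i : Fin (t + 1)) => y i ω) (ξ t) P → P.map (ξ t) = gam →
      IndepFun (fun ω => ((fun (i : Fin (t + 1)) => y i ω), ξ t ω)) (w (t + 1)) P →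
      P.map (e (t + 1)) = gam ∧ IndepFun (fun ω (i : Fin (t + 1)) => y i ω) (e (t + 1)) P ∧
      P.map (ξ (t + 1)) = gam ∧
      IndepFun (fun ω => ((fun (i : Fin (t + 1)) => y i ω), e (t + 1) ω)) (ξ (t + 1)) P := by
    intro t i1 i2 i3
    have hx : ∀ u ≤ t + 1, ∀ ω, RR F (ext t (fun i : Fin (t + 1) => y i ω)) u = R u ω := by
      intro u hu ω
      exact RR_congr F u fun i hi => ext_hist t (fun i => y i ω) i (by omega)
    have hRm' : ∀ u, Measurable (fun v : Fin (t + 1) → ℝ => RR F (ext t v) u) := fun u =>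
      meas_RR (y := fun i v => ext t v i) hF u (fun i _ => meas_ext t i)
    have hxl : ∀ v : Fin (t + 1) → ℝ, ext t v t = v (Fin.last t) := fun v => by
      simp [ext, Fin.last]
    refine rot_joint (fun ω (i : Fin (t + 1)) => y i ω) (measurable_pi_lambda _ fun i => hym _)
        (ξ t) (hξm t) (w (t + 1)) (hwm _) i1 i2 i3 (hw_gauss t)
        (c := fun v => F (v (Fin.last t)) / √(RR F (ext t v) (t + 1)))
        (s := fun v => √(RR F (ext t v) t) / √(RR F (ext t v) (t + 1)))
        ?_ ?_ ?_ ?_ ?_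
    · exact (hF.comp (measurable_pi_apply _)).div (hRm' _).sqrt
    · exact (hRm' _).sqrt.div (hRm' _).sqrt
    · intro v
      have h1 := RR_ge F (ext t v) t
      have h2 := RR_ge F (ext t v) (t + 1)
      have h3 := RR_succ F (ext t v) t
      rw [hxl] at h3
      rw [div_pow, div_pow, Real.sq_sqrt (by linarith), Real.sq_sqrt (by linarith), ← add_div, h3,
        add_comm, div_self]
      rw [← h3]; linarith
    · intro ω
      simp only [hx t (by omega), hx (t + 1) le_rfl]
      rfl
    · intro ω
      simp only [hx t (by omega), hx (t + 1) le_rfl]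
      exact hξs t ω
  have key : ∀ t, IndepFun (fun ω (i : Fin (t + 1)) => y i ω) (ξ t) P ∧ P.map (ξ t) = gam ∧
      IndepFun (fun ω => ((fun (i : Fin (t + 1)) => y i ω), ξ t ω)) (w (t + 1)) P := by
    have hpast : ∀ t, IndepFun (fun ω => ((fun (i : Fin (t + 1)) => y i ω), ξ t ω))
        (w (t + 1)) P := by
      intro t
      have h := indep_past θ hθm w hwm hw_indep hθw t
      rw [IndepFun_iff_Indep] at h ⊢
      refine indep_of_indep_of_le_left h ?_
      rw [← measurable_iff_comap_le]
      set m := MeasurableSpace.comap (fun ω => (θ ω, fun i : Fin t => w (i + 1) ω)) inferInstance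
      have hT : Measurable[m] (fun ω => (θ ω, fun i : Fin t => w (i + 1) ω)) :=
        comap_measurable _
      have h1 : Measurable[m] θ := measurable_fst.comp hT
      have h2 : ∀ i < t, Measurable[m] (w (i + 1)) := fun i hi =>
        (measurable_pi_apply (⟨i, hi⟩ : Fin t)).comp (measurable_snd.comp hT)
      have h3 := hmeas t m h1 h2
      refine Measurable.prodMk (measurable_pi_lambda _ fun i => h3 i (by omega)) ?_
      exact (meas_RR hF t (fun i hi => h3 i hi.le)).sqrt.mul
        ((h1.sub (meas_est hF θ₀ p t h3)).div_const _)
    intro t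
    induction t with
    | zero =>
      refine ⟨?_, ?_, hpast 0⟩
      · have : (fun ω (i : Fin (0 + 1)) => y i ω) = fun _ _ => y₀ := by
          funext ω i
          have : (i : ℕ) = 0 := by omega
          rw [this, hy0]
        rw [this]
        exact indepFun_const_left _ _
      · refine Eq.trans ?_ hθ_gauss
        congr 1
        funext ω
        simp [hξ, hR, RR, est]
    | succ t ih =>
      obtain ⟨i1, i2, i3⟩ := ih
      obtain ⟨j1, j2, j3, j4⟩ := hjoint t i1 i2 i3
      refine ⟨?_, j3, hpast _⟩
      have := j4.comp (_mγ := MeasurableSpace.pi) (φ := fun q : (Fin (t + 1) → ℝ) × ℝ =>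
        fun i : Fin (t + 2) => if hi : (i : ℕ) < t + 1 then q.1 ⟨i, hi⟩ else
          √(RR F (ext t q.1) (t + 1) / RR F (ext t q.1) t) * q.2) (ψ := id) ?_ measurable_id
      · rw [Function.id_comp] at this
        convert this using 1
        funext ω i
        simp only [Function.comp]
        split_ifs with hi
        · rfl
        · have : (i : ℕ) = t + 1 := by omega
          rw [this, hye, RR_congr F (t + 1) fun j hj => ext_hist t (fun i => y i ω) j (by omega),
            RR_congr F t fun j hj => ext_hist t (fun i => y i ω) j (by omega)]
      · have hRm' : ∀ u, Measurable (fun v : Fin (t + 1) → ℝ => RR F (ext t v) u) := fun u =>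
          meas_RR (y := fun i v => ext t v i) hF u (fun i _ => meas_ext t i)
        refine measurable_pi_lambda _ fun i => ?_
        split_ifs with hi
        · fun_prop
        · exact (((hRm' _).comp measurable_fst).div
            ((hRm' _).comp measurable_fst)).sqrt.mul measurable_snd
  refine ⟨e, hem, hym, ?_, ?_, hye⟩
  · exact fun t => (hjoint t (key t).1 (key t).2.1 (key t).2.2).1
  · exact fun t => (hjoint t (key t).1 (key t).2.1 (key t).2.2).2.1
end
end Stab

end

-- part B
noncomputable section
namespace Stab

/-- Constants of the pathwise analysis. -/
structure Cst where
  (a b ρ₀ ρ₁ δ κ Λs η : ℝ)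
  N : ℕ
  ha : 4 ≤ a
  hb : 0 ≤ b
  h0 : 1 < ρ₀
  hδ : 0 < δ
  hδ2 : δ ≤ 1 / 2
  h0δ : 1 + δ < ρ₀
  hκ : 0 < κ
  hρ1 : 1 ≤ ρ₁
  hhi : ∀ ρ, ρ₁ ≤ ρ → a * (1 - 1 / ρ) + δ ≤ ρ - κ
  hlo : ∀ ρ, 1 ≤ ρ → ρ ≤ ρ₀ → a * (1 - 1 / ρ) + δ ≤ ρ - κ
  hhit : b * (1 - 1 / ρ₁) + δ < ρ₀
  hN2 : 2 ≤ N
  hN : a + 1 - (N - 2) * κ ≤ ρ₁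
  hη : 0 < η
  hΛN : (N : ℝ) ^ 2 ≤ Λs
  hΛa : 2 * a ≤ Λs
  hΛρ : ρ₀ ≤ Λs
  hΛ2 : Real.log 2 ≤ δ * Λs

/-- The pathwise facts. -/
structure Path (c : Cst) (Λ E : ℕ → ℝ) (hit : ℕ → Prop) : Prop where
  mono : ∀ s, Λ s ≤ Λ (s + 1)
  zero : Λ 0 = 0
  hE : ∀ s, c.δ * c.Λs ≤ E s
  step : ∀ s, Λ (s + 2) ≤ Λ (s + 1) + Real.log 2 ∨
    Λ (s + 2) ≤ c.a * (Λ (s + 1) - Λ s) + E (s + 1)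
  hits : ∀ s, hit (s + 1) → Λ (s + 2) ≤ Λ (s + 1) + Real.log 2 ∨
    Λ (s + 2) ≤ c.b * (Λ (s + 1) - Λ s) + E (s + 1)

/-- jump at time `s`, from values `Λ s`, `Λ (s+1)` -/
def Jump (c : Cst) (Λ : ℕ → ℝ) (s : ℕ) : Prop := c.ρ₀ * Λ s ≤ Λ (s + 1) ∧ c.Λs ≤ Λ (s + 1)
/-- fresh time -/
def Fresh (c : Cst) (Λ E : ℕ → ℝ) (s : ℕ) : Prop := c.δ * Λ s < E s

/-- weight -/
def qq (c : Cst) (H : ℝ) (n : ℕ) : ℝ := √H + max (n : ℝ) c.N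

open Classical in
/-- State: number of counted excursions, starting height, length. -/
def st (c : Cst) (Λ E : ℕ → ℝ) : ℕ → ℕ × ℝ × ℕ
  | 0 => if Jump c Λ 0 then (0, Λ 1, 1) else (0, 1, 0)
  | s + 1 =>
    if Jump c Λ (s + 1) then
      if Fresh c Λ E (s + 1) then ((st c Λ E s).1, Λ (s + 2), 1)
      else if c.η * (st c Λ E s).2.1 ≤ qq c (st c Λ E s).2.1 ((st c Λ E s).2.2 + 1) then
        ((st c Λ E s).1 + 1, Λ (s + 2), 1)
      else ((st c Λ E s).1, (st c Λ E s).2.1, (st c Λ E s).2.2 + 1)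
    else ((st c Λ E s).1, (st c Λ E s).2.1, 0)

section
variable {c : Cst} {Λ E : ℕ → ℝ} {hit : ℕ → Prop}

lemma Cst.Λs_pos (c : Cst) : 8 ≤ c.Λs := by have := c.hΛa; have := c.ha; linarith

lemma Path.nonneg (p : Path c Λ E hit) (s : ℕ) : 0 ≤ Λ s := by
  induction s with
  | zero => rw [p.zero]
  | succ s ih => exact ih.trans (p.mono s)

lemma Path.nf (p : Path c Λ E hit) {s : ℕ} (h : ¬ Fresh c Λ E s) : c.Λs ≤ Λ s := by
  unfold Fresh at h
  have := p.hE s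
  exact le_of_mul_le_mul_left (by linarith) c.hδ

/-- ratio form of a one step bound -/
lemma ratio_step {k X Y Z δ : ℝ} (hY : 0 < Y) (hZ : Z ≤ k * (Y - X) + δ * Y) {ρ : ℝ} (hk : 0 ≤ k)
    (hρ : 0 < ρ) (hX : Y ≤ ρ * X) : Z ≤ (k * (1 - 1 / ρ) + δ) * Y := by
  have h1 : Y / ρ ≤ X := by rw [div_le_iff₀ hρ]; linarith
  have : (k * (1 - 1 / ρ) + δ) * Y = k * (Y - Y / ρ) + δ * Y := by field_simp
  rw [this]
  nlinarith [mul_le_mul_of_nonneg_left h1 hk]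

lemma Path.nfstep (p : Path c Λ E hit) {s : ℕ} (h : ¬ Fresh c Λ E (s + 1)) :
    Λ (s + 2) ≤ (1 + c.δ) * Λ (s + 1) ∨
    Λ (s + 2) ≤ c.a * (Λ (s + 1) - Λ s) + c.δ * Λ (s + 1) := by
  have h1 := p.nf h
  unfold Fresh at h
  rcases p.step s with h2 | h2
  · left
    have := c.hΛ2
    nlinarith [c.hδ]
  · right; linarith

lemma Path.nfhit (p : Path c Λ E hit) {s : ℕ} (h : ¬ Fresh c Λ E (s + 1)) (hh : hit (s + 1)) :
    Λ (s + 2) ≤ (1 + c.δ) * Λ (s + 1) ∨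
    Λ (s + 2) ≤ c.b * (Λ (s + 1) - Λ s) + c.δ * Λ (s + 1) := by
  have h1 := p.nf h
  unfold Fresh at h
  rcases p.hits s hh with h2 | h2
  · left
    have := c.hΛ2
    nlinarith [c.hδ]
  · right; linarith

/-- A non-fresh step multiplies by at most `a+1`. -/
lemma Path.nfA (p : Path c Λ E hit) {s : ℕ} (h : ¬ Fresh c Λ E (s + 1)) :
    Λ (s + 2) ≤ (c.a + 1) * Λ (s + 1) := by
  have h1 := p.nf h
  have h2 := c.Λs_pos
  have h3 := p.nonneg s
  have := c.hδ2; have := c.ha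
  rcases p.nfstep h with h | h
  · nlinarith
  · nlinarith

/-- non-fresh jumps follow jumps -/
lemma Path.jump_prev (p : Path c Λ E hit) {s : ℕ} (h : ¬ Fresh c Λ E (s + 1))
    (hj : Jump c Λ (s + 1)) : Jump c Λ s := by
  have h1 := p.nf h
  have h2 := c.Λs_pos
  refine ⟨?_, h1⟩
  by_contra hlt
  push Not at hlt
  have hj1 := hj.1
  have hpos : 0 < Λ (s + 1) := by linarith
  rcases p.nfstep h with h | h
  · have := c.h0δ
    nlinarith
  · have h3 := ratio_step hpos h (by have := c.ha; linarith) (by have := c.h0; linarith) hlt.le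
    have h4 := c.hlo c.ρ₀ c.h0.le le_rfl
    have := c.hκ
    have h5 : Λ (s + 2) < c.ρ₀ * Λ (s + 1) := by
      refine h3.trans_lt ?_
      apply mul_lt_mul_of_pos_right _ hpos
      linarith
    linarith

/-- hits with controlled ratio kill -/
lemma Path.hit_kill (p : Path c Λ E hit) {s : ℕ} (h : ¬ Fresh c Λ E (s + 1))
    (hh : hit (s + 1)) (hr : Λ (s + 1) ≤ c.ρ₁ * Λ s) : ¬ Jump c Λ (s + 1) := by
  intro hj
  have h1 := p.nf h
  have h2 := c.Λs_pos
  have hj1 := hj.1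
  have hpos : 0 < Λ (s + 1) := by linarith
  rcases p.nfhit h hh with h | h
  · have := c.h0δ
    nlinarith
  · have h3 := ratio_step hpos h c.hb (by have := c.hρ1; linarith) hr
    have h5 : Λ (s + 2) < c.ρ₀ * Λ (s + 1) := by
      refine h3.trans_lt ?_
      apply mul_lt_mul_of_pos_right c.hhit hpos
    linarith

/-- warm-up -/
lemma Path.warm (p : Path c Λ E hit) {s : ℕ} (h : ¬ Fresh c Λ E (s + 1)) {r : ℝ}
    (hr : Λ (s + 1) ≤ max c.ρ₁ r * Λ s) : Λ (s + 2) ≤ max c.ρ₁ (r - c.κ) * Λ (s + 1) := by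
  have h1 := p.nf h
  have h2 := c.Λs_pos
  have hpos : 0 < Λ (s + 1) := by linarith
  have hρ1 := c.hρ1
  have hk := c.hκ
  have key : c.a * (1 - 1 / max c.ρ₁ r) + c.δ ≤ max c.ρ₁ (r - c.κ) := by
    refine (c.hhi _ (le_max_left _ _)).trans ?_
    rcases le_total c.ρ₁ r with h | h
    · rw [max_eq_right h]; exact le_max_right _ _
    · rw [max_eq_left h]; exact le_trans (by linarith) (le_max_left _ _)
  rcases p.nfstep h with h | h
  · refine h.trans (mul_le_mul_of_nonneg_right ?_ hpos.le)
    have h3 := c.hhi c.ρ₁ le_rfl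
    refine le_trans ?_ (le_max_left _ _)
    by_contra hlt
    push Not at hlt
    by_cases h4 : c.ρ₁ ≤ c.ρ₀
    · have := c.hhi c.ρ₀ h4
      have h5 := c.hhit
      have h6 : c.ρ₁ < 2 := by have := c.hδ2; linarith
      have h8 := c.hhi 2 h6.le
      have := c.ha
      have := c.hδ
      nlinarith
    · push Not at h4
      have := c.h0δ
      linarith
  · have h3 := ratio_step hpos h (by have := c.ha; linarith)
      (lt_of_lt_of_le (by linarith) (le_max_left c.ρ₁ r)) hr
    exact h3.trans (mul_le_mul_of_nonneg_right key hpos.le)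

/-- The invariants of the state. -/
structure Inv (c : Cst) (Λ E : ℕ → ℝ) (s : ℕ) : Prop where
  pos_iff : 1 ≤ (st c Λ E s).2.2 ↔ Jump c Λ s
  ht : 1 ≤ (st c Λ E s).2.2 → c.Λs ≤ (st c Λ E s).2.1
  bd : 1 ≤ (st c Λ E s).2.2 → Λ (s + 1) ≤ (st c Λ E s).2.1 * (c.a + 1) ^ (st c Λ E s).2.2
  two : 2 ≤ (st c Λ E s).2.2 → c.Λs ≤ Λ s ∧
    Λ (s + 1) ≤ max c.ρ₁ (c.a + 1 - ((st c Λ E s).2.2 - 2) * c.κ) * Λ s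

lemma Path.inv (p : Path c Λ E hit) (s : ℕ) : Inv c Λ E s := by
  have ha := c.ha
  have hΛs := c.Λs_pos
  induction s with
  | zero =>
    by_cases hj : Jump c Λ 0
    · have hj2 := hj.2
      simp only [zero_add] at hj2
      constructor <;> simp only [st, hj, if_true] <;> norm_num
      · exact hj2
      · nlinarith
    · constructor <;> simp only [st, hj, if_false] <;> norm_num
  | succ s ih =>
    by_cases hj : Jump c Λ (s + 1)
    · have hj2 := hj.2
      by_cases hf : Fresh c Λ E (s + 1)
      · constructor <;> simp only [st, hj, if_true, hf] <;> norm_num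
        · exact hj2
        · nlinarith
      · by_cases hq : c.η * (st c Λ E s).2.1 ≤ qq c (st c Λ E s).2.1 ((st c Λ E s).2.2 + 1)
        · constructor <;> simp only [st, hj, if_true, hf, if_false, hq] <;> norm_num
          · exact hj2
          · nlinarith
        · have hjs := p.jump_prev hf hj
          have hn := ih.pos_iff.2 hjs
          have h1 := p.nfA hf
          constructor <;> simp only [st, hj, if_true, hf, if_false, hq]
          · simp
          · intro _; exact ih.ht hn
          · intro _
            rw [pow_succ]
            have := ih.bd hn
            nlinarith
          · intro _
            refine ⟨p.nf hf, ?_⟩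
            push_cast
            rcases Nat.lt_or_ge (st c Λ E s).2.2 2 with h2 | h2
            · have : (st c Λ E s).2.2 = 1 := by omega
              rw [this]
              refine h1.trans (mul_le_mul_of_nonneg_right ?_ (p.nonneg _))
              refine le_trans ?_ (le_max_right _ _)
              norm_num
            · have := p.warm hf (ih.two h2).2
              convert this using 3
              ring
    · constructor <;> simp only [st, hj, if_false] <;> norm_num

end
end Stab

end

-- part B2
noncomputable section
namespace Stab

/-- decreasing part of the potential -/
def psi (α K x : ℝ) : ℝ := K * (max 1 x) ^ (-(α / 2))

/-- price of an excursion -/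
def price (c : Cst) (α H : ℝ) (n : ℕ) : ℝ := (qq c H n / (c.η * H)) ^ α

/-- the price attached to the present state -/
def UU (c : Cst) (α : ℝ) (x : ℕ × ℝ × ℕ) : ℝ := if x.2.2 = 0 then 0 else price c α x.2.1 x.2.2

/-- the potential -/
def VV (c : Cst) (α K : ℝ) (Λ E : ℕ → ℝ) (s : ℕ) : ℝ :=
  (st c Λ E s).1 + UU c α (st c Λ E s) + psi α K (Λ (s + 1))

lemma psi_nonneg {α K x : ℝ} (hK : 0 ≤ K) : 0 ≤ psi α K x := by
  unfold psi; positivity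

lemma psi_anti {α K x x' : ℝ} (hα : 0 < α) (hK : 0 ≤ K) (h : x ≤ x') :
    psi α K x' ≤ psi α K x := by
  unfold psi
  apply mul_le_mul_of_nonneg_left _ hK
  apply Real.rpow_le_rpow_of_nonpos
  · positivity
  · exact max_le_max le_rfl h
  · linarith

lemma qq_pos (c : Cst) (H : ℝ) (n : ℕ) : 0 < qq c H n := by
  unfold qq
  have h : (2:ℝ) ≤ c.N := by exact_mod_cast c.hN2
  have h1 : (c.N : ℝ) ≤ max (n : ℝ) c.N := le_max_right _ _
  have := Real.sqrt_nonneg H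
  linarith

lemma price_nonneg (c : Cst) {α H : ℝ} (hH : 0 ≤ H) (n : ℕ) : 0 ≤ price c α H n := by
  unfold price
  have := qq_pos c H n
  have := c.hη
  positivity

lemma start_cost (c : Cst) {α K x x' : ℝ} (hα : 0 < α) (hK : 0 ≤ K)
    (hKc : K + (2 / c.η) ^ α ≤ K * c.ρ₀ ^ (α / 2)) (h1 : c.ρ₀ * x ≤ x') (h2 : c.Λs ≤ x') :
    price c α x' 1 + psi α K x' ≤ psi α K x := by
  have h8 := c.Λs_pos
  have hρ := c.h0
  have hη := c.hη
  have hx' : 0 < x' := by linarith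
  have hm : c.ρ₀ * max 1 x ≤ x' := by
    rcases le_total 1 x with h | h
    · rwa [max_eq_right h]
    · rw [max_eq_left h]; have := c.hΛρ; linarith
  have hq : qq c x' 1 ≤ 2 * √x' := by
    unfold qq
    have hN : (2:ℝ) ≤ c.N := by exact_mod_cast c.hN2
    have : (c.N:ℝ) ≤ √x' := Real.le_sqrt_of_sq_le (c.hΛN.trans h2)
    rw [max_eq_right (by push_cast; linarith)]
    linarith
  have hp : price c α x' 1 ≤ (2 / c.η) ^ α * x' ^ (-(α / 2)) := by
    unfold price
    have h3 : qq c x' 1 / (c.η * x') ≤ (2 / c.η) * x' ^ (-(1 / 2) : ℝ) := by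
      rw [Real.rpow_neg hx'.le, ← Real.sqrt_eq_rpow, div_le_iff₀ (by positivity)]
      refine hq.trans (le_of_eq ?_)
      have : √x' ≠ 0 := by positivity
      field_simp
      rw [Real.sq_sqrt hx'.le]
    refine (Real.rpow_le_rpow (by have := qq_pos c x' 1; positivity) h3 hα.le).trans ?_
    rw [Real.mul_rpow (by positivity) (by positivity), ← Real.rpow_mul hx'.le]
    apply le_of_eq
    congr 2
    ring
  have hpsi : psi α K x' = K * x' ^ (-(α / 2)) := by
    unfold psi; rw [max_eq_right (by linarith)]
  rw [hpsi]
  unfold psi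
  set m := max 1 x with hmdef
  have hm1 : 1 ≤ m := le_max_left _ _
  have h4 : x' ^ (-(α / 2)) ≤ (c.ρ₀ * m) ^ (-(α / 2)) :=
    Real.rpow_le_rpow_of_nonpos (by positivity) hm (by linarith)
  rw [Real.mul_rpow (by linarith) (by linarith), Real.rpow_neg (by linarith : (0:ℝ) ≤ c.ρ₀)] at h4
  have hR : 0 < c.ρ₀ ^ (α / 2) := by positivity
  have hM : 0 < m ^ (-(α / 2)) := by positivity
  have hC : 0 ≤ (2 / c.η) ^ α := by positivity
  calc _ ≤ (K + (2 / c.η) ^ α) * x' ^ (-(α / 2)) := by linarith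
    _ ≤ (K + (2 / c.η) ^ α) * ((c.ρ₀ ^ (α / 2))⁻¹ * m ^ (-(α / 2))) :=
        mul_le_mul_of_nonneg_left h4 (by linarith)
    _ ≤ (K * c.ρ₀ ^ (α / 2)) * ((c.ρ₀ ^ (α / 2))⁻¹ * m ^ (-(α / 2))) :=
        mul_le_mul_of_nonneg_right hKc (by positivity)
    _ = K * m ^ (-(α / 2)) := by field_simp

variable {c : Cst} {Λ E : ℕ → ℝ} {hit : ℕ → Prop}

open Classical in
lemma Path.VV_succ (p : Path c Λ E hit) {α K : ℝ} (hα : 0 < α) (hK : 0 ≤ K)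
    (hKc : K + (2 / c.η) ^ α ≤ K * c.ρ₀ ^ (α / 2)) (s : ℕ) :
    VV c α K Λ E (s + 1) ≤ (st c Λ E s).1 + psi α K (Λ (s + 1)) +
      (if (st c Λ E s).2.2 = 0 then 0 else
        if c.N ≤ (st c Λ E s).2.2 ∧ hit (s + 1) then 0 else
          price c α (st c Λ E s).2.1 ((st c Λ E s).2.2 + 1)) := by
  have I := p.inv s
  have hmono := psi_anti hα hK (p.mono (s + 1))
  have hlast : (0:ℝ) ≤ (if (st c Λ E s).2.2 = 0 then 0 else
        if c.N ≤ (st c Λ E s).2.2 ∧ hit (s + 1) then 0 else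
          price c α (st c Λ E s).2.1 ((st c Λ E s).2.2 + 1)) := by
    split_ifs with h1 h2
    · exact le_rfl
    · exact le_rfl
    · have := I.ht (by omega)
      have h8 := c.Λs_pos
      exact price_nonneg c (by linarith) _
  unfold VV
  by_cases hj : Jump c Λ (s + 1)
  · have hst := start_cost c hα hK hKc hj.1 hj.2
    by_cases hf : Fresh c Λ E (s + 1)
    · simp only [st, hj, hf, if_true, UU, one_ne_zero, if_false]
      have : s + 1 + 1 = s + 2 := rfl
      rw [this] at *
      linarith
    · have hn := I.pos_iff.2 (p.jump_prev hf hj)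
      have hH := I.ht hn
      have h8 := c.Λs_pos
      have hη := c.hη
      have hnh : ¬ (c.N ≤ (st c Λ E s).2.2 ∧ hit (s + 1)) := by
        rintro ⟨hN, hh⟩
        have hN2 := c.hN2
        have h2 := (I.two (by omega)).2
        refine p.hit_kill hf hh ?_ hj
        rwa [max_eq_left] at h2
        refine le_trans ?_ c.hN
        have : (c.N : ℝ) ≤ (st c Λ E s).2.2 := by exact_mod_cast hN
        nlinarith [c.hκ]
      have hn0 : (st c Λ E s).2.2 ≠ 0 := by omega
      rw [if_neg hn0, if_neg hnh]
      by_cases hq : c.η * (st c Λ E s).2.1 ≤ qq c (st c Λ E s).2.1 ((st c Λ E s).2.2 + 1)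
      · simp only [st, hj, hf, if_true, UU, one_ne_zero, if_false, hq]
        have h1 : 1 ≤ price c α (st c Λ E s).2.1 ((st c Λ E s).2.2 + 1) := by
          unfold price
          apply Real.one_le_rpow _ hα.le
          rw [le_div_iff₀ (by apply mul_pos hη; linarith)]
          linarith
        have : s + 1 + 1 = s + 2 := rfl
        rw [this] at *
        push_cast
        linarith
      · simp only [st, hj, hf, if_true, UU, if_false, hq, Nat.succ_ne_zero]
        linarith
  · simp only [st, hj, if_false, UU, if_true]
    linarith

lemma price_succ_small (c : Cst) {α H : ℝ} {n : ℕ} (h : n < c.N) :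
    price c α H (n + 1) = price c α H n := by
  unfold price qq
  have h1 : (n : ℝ) ≤ c.N := by exact_mod_cast h.le
  have h2 : ((n + 1 : ℕ) : ℝ) ≤ c.N := by exact_mod_cast h
  rw [max_eq_right h1, max_eq_right h2]

lemma price_succ (c : Cst) {α H : ℝ} {n : ℕ} (hα : 0 < α) (hα1 : α ≤ 1) (hH : 0 < H)
    (h : c.N ≤ n) :
    price c α H (n + 1) ≤ price c α H n * (1 + α / (√H + n)) := by
  have hN := c.hN2
  have hη := c.hη
  have hq : qq c H n = √H + n := by
    unfold qq; rw [max_eq_left (by exact_mod_cast h)]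
  have hq1 : qq c H (n + 1) = (√H + n) * (1 + 1 / (√H + n)) := by
    have h0 : (0:ℝ) < √H + n := by rw [← hq]; exact qq_pos c H n
    unfold qq; rw [max_eq_left (by exact_mod_cast (by omega : c.N ≤ n + 1))]
    push_cast
    field_simp
    ring
  have h0 : (0:ℝ) < √H + n := by rw [← hq]; exact qq_pos c H n
  unfold price
  rw [hq, hq1]
  have e : (√H + n) * (1 + 1 / (√H + n)) / (c.η * H) =
      ((√H + n) / (c.η * H)) * (1 + 1 / (√H + n)) := by ring
  rw [e, Real.mul_rpow (by positivity) (by positivity)]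
  apply mul_le_mul_of_nonneg_left _ (by positivity)
  have hb := rpow_one_add_le_one_add_mul_self (s := 1 / (√H + n)) (p := α)
    (by have : (0:ℝ) ≤ 1 / (√H + n) := by positivity
        linarith) hα.le hα1
  refine hb.trans (le_of_eq ?_)
  ring

end Stab

end

-- part C1
noncomputable section
namespace Stab

/-- log of the information -/
def lam (F : ℝ → ℝ) (z : ℕ → ℝ) (t : ℕ) : ℝ := Real.log (RR F z t)
/-- standard deviation of the prediction -/
def sg (F : ℝ → ℝ) (z : ℕ → ℝ) (s : ℕ) : ℝ := √(RR F z (s + 1) / RR F z s)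
/-- normalized innovation -/
def ee (F : ℝ → ℝ) (z : ℕ → ℝ) : ℕ → ℝ
  | 0 => 0
  | s + 1 => z (s + 1) / sg F z s
/-- error term -/
def EE (c : Cst) (F : ℝ → ℝ) (z : ℕ → ℝ) (s : ℕ) : ℝ :=
  c.δ * c.Λs + 2 * c.a * Real.log (1 + |ee F z s|)

lemma RR_pos (F : ℝ → ℝ) (z : ℕ → ℝ) (s : ℕ) : 0 < RR F z s :=
  lt_of_lt_of_le one_pos (RR_ge F z s)

lemma RR_mono (F : ℝ → ℝ) (z : ℕ → ℝ) (s : ℕ) : RR F z s ≤ RR F z (s + 1) := by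
  rw [RR_succ]; nlinarith [sq_nonneg (F (z s))]

lemma sg_ge (F : ℝ → ℝ) (z : ℕ → ℝ) (s : ℕ) : 1 ≤ sg F z s := by
  unfold sg
  rw [Real.le_sqrt' one_pos, le_div_iff₀ (RR_pos F z s)]
  have := RR_mono F z s
  linarith

lemma sg_sq (F : ℝ → ℝ) (z : ℕ → ℝ) (s : ℕ) : sg F z s ^ 2 = RR F z (s + 1) / RR F z s := by
  unfold sg
  rw [Real.sq_sqrt]
  have := RR_pos F z s; have := RR_pos F z (s + 1)
  positivity

lemma log_sg (F : ℝ → ℝ) (z : ℕ → ℝ) (s : ℕ) :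
    2 * Real.log (sg F z s) = lam F z (s + 1) - lam F z s := by
  have h := congrArg Real.log (sg_sq F z s)
  rw [Real.log_pow, Real.log_div (RR_pos _ _ _).ne' (RR_pos _ _ _).ne'] at h
  push_cast at h
  exact h

lemma z_eq (F : ℝ → ℝ) (z : ℕ → ℝ) (s : ℕ) : z (s + 1) = sg F z s * ee F z (s + 1) := by
  have := sg_ge F z s
  simp only [ee]
  field_simp

lemma step_gen {F : ℝ → ℝ} {z : ℕ → ℝ} {s : ℕ} {C0 k : ℝ} (hk : 0 ≤ k) (hC : 1 ≤ C0)
    (h : |F (z (s + 1))| ≤ C0 * (1 + |z (s + 1)|) ^ k) :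
    lam F z (s + 2) ≤ lam F z (s + 1) + Real.log 2 ∨
    lam F z (s + 2) ≤ k * (lam F z (s + 1) - lam F z s) +
      (Real.log 2 + 2 * Real.log C0 + 2 * k * Real.log (1 + |ee F z (s + 1)|)) := by
  have hR : RR F z (s + 2) = RR F z (s + 1) + F (z (s + 1)) ^ 2 := RR_succ _ _ _
  have hRp := RR_pos F z (s + 1)
  have hRp2 := RR_pos F z (s + 2)
  have hs := sg_ge F z s
  unfold lam
  rcases le_total (F (z (s + 1)) ^ 2) (RR F z (s + 1)) with hle | hle
  · left
    rw [← Real.log_mul hRp.ne' (by norm_num)]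
    exact Real.log_le_log hRp2 (by linarith)
  · right
    have hz : 1 + |z (s + 1)| ≤ sg F z s * (1 + |ee F z (s + 1)|) := by
      rw [z_eq F z s, abs_mul, abs_of_pos (by linarith)]
      nlinarith [abs_nonneg (ee F z (s + 1))]
    have h2 : |F (z (s + 1))| ≤ C0 * (sg F z s * (1 + |ee F z (s + 1)|)) ^ k := by
      refine h.trans ?_
      gcongr
    have h3 : RR F z (s + 2) ≤ 2 * (C0 * (sg F z s * (1 + |ee F z (s + 1)|)) ^ k) ^ 2 := by
      have : F (z (s + 1)) ^ 2 ≤ (C0 * (sg F z s * (1 + |ee F z (s + 1)|)) ^ k) ^ 2 := by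
        rw [← sq_abs]
        gcongr
      linarith
    have hb : 0 < sg F z s * (1 + |ee F z (s + 1)|) := by positivity
    have h4 := Real.log_le_log hRp2 h3
    have hkb : 0 < (sg F z s * (1 + |ee F z (s + 1)|)) ^ k := by positivity
    rw [Real.log_mul (by norm_num) (by positivity), Real.log_pow,
      Real.log_mul (by positivity) hkb.ne', Real.log_rpow hb,
      Real.log_mul (by positivity) (by positivity)] at h4
    have h5 := log_sg F z s
    unfold lam at h5
    push_cast at h4
    rw [← h5]
    linarith

/-- the hit event -/
def Hit (F : ℝ → ℝ) (S : Set ℝ) (z : ℕ → ℝ) : ℕ → Prop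
  | 0 => False
  | s + 1 => |ee F z (s + 1)| ≤ 1 ∧ sg F z s * ee F z (s + 1) ∈ S

lemma path_lam (c : Cst) (F : ℝ → ℝ) (S : Set ℝ) (z : ℕ → ℝ) {C0 : ℝ} (hC : 1 ≤ C0)
    (hba : c.b ≤ c.a) (h1 : ∀ x, |F x| ≤ C0 * (1 + |x|) ^ c.a)
    (h2 : ∀ x ∈ S, |F x| ≤ C0 * (1 + |x|) ^ c.b)
    (hK : Real.log 2 + 2 * Real.log C0 ≤ c.δ * c.Λs) :
    Path c (lam F z) (EE c F z) (Hit F S z) := by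
  have ha := c.ha
  have hlog : ∀ s, 0 ≤ Real.log (1 + |ee F z s|) := fun s =>
    Real.log_nonneg (by have := abs_nonneg (ee F z s); linarith)
  refine ⟨fun s => Real.log_le_log (RR_pos _ _ _) (RR_mono _ _ _), ?_, ?_, ?_, ?_⟩
  · simp [lam, RR_zero]
  · intro s
    unfold EE
    have := hlog s
    have : 0 ≤ 2 * c.a * Real.log (1 + |ee F z s|) := by positivity
    linarith
  · intro s
    rcases step_gen (by linarith) hC (h1 (z (s + 1))) with h | h
    · exact Or.inl h
    · right; unfold EE; linarith
  · intro s hh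
    have hS : z (s + 1) ∈ S := by rw [z_eq F z s]; exact hh.2
    rcases step_gen c.hb hC (h2 _ hS) with h | h
    · exact Or.inl h
    · right; unfold EE
      have := mul_le_mul_of_nonneg_right hba (hlog (s + 1))
      linarith

/-! measurability -/

section
variable {Ω : Type*} {m : MeasurableSpace Ω} {F : ℝ → ℝ} {y : ℕ → Ω → ℝ}

lemma meas_lam (hF : Measurable F) {t : ℕ} (h : ∀ i < t, Measurable (y i)) :
    Measurable (fun ω => lam F (fun i => y i ω) t) :=
  Real.measurable_log.comp (meas_RR hF _ h)

lemma meas_sg (hF : Measurable F) {s : ℕ} (h : ∀ i < s + 1, Measurable (y i)) :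
    Measurable (fun ω => sg F (fun i => y i ω) s) :=
  Real.continuous_sqrt.measurable.comp
    ((meas_RR hF _ h).div (meas_RR hF _ (fun i hi => h i (by omega))))

lemma meas_ee (hF : Measurable F) {s : ℕ} (h : ∀ i < s + 1, Measurable (y i)) :
    Measurable (fun ω => ee F (fun i => y i ω) s) := by
  cases s with
  | zero => exact measurable_const
  | succ s =>
    exact (h _ (by omega)).div (meas_sg hF (fun i hi => h i (by omega)))

lemma meas_EE (hF : Measurable F) (c : Cst) {s : ℕ} (h : ∀ i < s + 1, Measurable (y i)) :
    Measurable (fun ω => EE c F (fun i => y i ω) s) := by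
  unfold EE
  have := meas_ee hF h
  fun_prop

lemma meas_st (hF : Measurable F) (c : Cst) {s : ℕ} (h : ∀ i < s + 1, Measurable (y i)) :
    Measurable (fun ω => st c (lam F (fun i => y i ω)) (EE c F (fun i => y i ω)) s) := by
  classical
  have hJ : ∀ {s}, (∀ i < s + 1, Measurable (y i)) →
      MeasurableSet {ω | Jump c (lam F (fun i => y i ω)) s} := by
    intro s h
    have h1 := meas_lam hF h
    have h2 := meas_lam hF (t := s) (fun i hi => h i (by omega))
    exact (measurableSet_le (h2.const_mul _) h1).inter (measurableSet_le measurable_const h1)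
  induction s with
  | zero =>
    simp only [st]
    refine Measurable.ite (hJ h) ?_ measurable_const
    exact measurable_const.prodMk ((meas_lam hF h).prodMk measurable_const)
  | succ s ih =>
    have ih := ih (fun i hi => h i (by omega))
    have hE := meas_EE hF c h
    have hl1 := meas_lam hF (t := s + 1) (fun i hi => h i (by omega))
    have hl2 := meas_lam hF (t := s + 2) (fun i hi => h i (by omega))
    simp only [st]
    have m1 := ih.fst
    have m2 := ih.snd.fst
    have m3 := ih.snd.snd
    refine Measurable.ite (hJ h) (Measurable.ite ?_ ?_ (Measurable.ite ?_ ?_ ?_)) ?_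
    · exact measurableSet_lt (hl1.const_mul _) hE
    · exact m1.prodMk (hl2.prodMk measurable_const)
    · unfold qq
      apply measurableSet_le (m2.const_mul _)
      apply (Real.continuous_sqrt.measurable.comp m2).add
      have : Measurable (fun n : ℕ => max (((n + 1 : ℕ)) : ℝ) (c.N : ℝ)) := measurable_of_countable _
      exact this.comp m3
    · exact (m1.add_const 1).prodMk (hl2.prodMk measurable_const)
    · exact m1.prodMk (m2.prodMk (m3.add_const 1))
    · exact m1.prodMk (m2.prodMk measurable_const)

end
end Stab

end

-- part C2
noncomputable section
namespace Stab

variable {Ω : Type*} [MeasurableSpace Ω] {P : Measure Ω} [IsProbabilityMeasure P]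

lemma tonelli {T : Type*} [MeasurableSpace T] {X : Ω → T} {e : Ω → ℝ} (hX : Measurable X)
    (he : Measurable e) (hind : IndepFun X e P) (hlaw : P.map e = gam)
    {Φ : T × ℝ → ENNReal} (hΦ : Measurable Φ) :
    ∫⁻ ω, Φ (X ω, e ω) ∂P = ∫⁻ ω, ∫⁻ u, Φ (X ω, u) ∂gam ∂P := by
  have h1 : P.map (fun ω => (X ω, e ω)) = (P.map X).prod gam := by
    rw [← hlaw]
    exact (indepFun_iff_map_prod_eq_prod_map_map hX.aemeasurable he.aemeasurable).1 hind
  have hp : IsProbabilityMeasure (P.map X) := Measure.isProbabilityMeasure_map hX.aemeasurable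
  rw [← lintegral_map hΦ (hX.prodMk he), h1, lintegral_prod _ hΦ.aemeasurable,
    lintegral_map hΦ.lintegral_prod_right' hX]

/-- what we know about the closed loop -/
structure Model (P : Measure Ω) (F : ℝ → ℝ) (y₀ : ℝ) (y : ℕ → Ω → ℝ) : Prop where
  mF : Measurable F
  y0 : ∀ ω, y 0 ω = y₀
  my : ∀ t, Measurable (y t)
  law : ∀ t, P.map (fun ω => ee F (fun i => y i ω) (t + 1)) = gam
  ind : ∀ t, IndepFun (fun ω (i : Fin (t + 1)) => y i ω)
    (fun ω => ee F (fun i => y i ω) (t + 1)) P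

/-- hit probabilities -/
def HitProb (S : Set ℝ) (c1 σ0 : ℝ) : Prop :=
  ∀ σ, σ0 ≤ σ → c1 / Real.log (Real.log σ) ≤ gam.real {u | |u| ≤ 1 ∧ σ * u ∈ S}

/-- the key numerical fact: hit probability beats the growth of the price -/
lemma hit_ge {c : Cst} {F : ℝ → ℝ} {S : Set ℝ} {z : ℕ → ℝ} {hit : ℕ → Prop} {α c1 σ0 : ℝ}
    (p : Path c (lam F z) (EE c F z) hit) (hS : HitProb S c1 σ0)
    (hα : 0 < α) (hαc : α * (2 * Real.log (c.a + 1)) ≤ c1) (hσ0 : Real.exp 1 < σ0)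
    (hΛσ : Real.log σ0 ≤ (c.ρ₀ - 1) * c.Λs / 2) (s : ℕ)
    (hn : c.N ≤ (st c (lam F z) (EE c F z) s).2.2) :
    α / (√(st c (lam F z) (EE c F z) s).2.1 + (st c (lam F z) (EE c F z) s).2.2) ≤
      gam.real {u | |u| ≤ 1 ∧ sg F z s * u ∈ S} := by
  have I := p.inv s
  have hN := c.hN2
  have h8 := c.Λs_pos
  have ha := c.ha
  set H := (st c (lam F z) (EE c F z) s).2.1
  set n := (st c (lam F z) (EE c F z) s).2.2
  have h1 : 1 ≤ n := by omega
  have hH := I.ht h1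
  have hbd := I.bd h1
  have hj := (I.pos_iff.1 h1)
  have ht := (I.two (by omega)).1
  have hs := log_sg F z s
  have hs1 := sg_ge F z s
  have hσpos : 0 < σ0 := lt_trans (Real.exp_pos 1) hσ0
  have hlogge : Real.log σ0 ≤ Real.log (sg F z s) := by
    have := hj.1
    have h0 := c.h0
    nlinarith
  have hσ : σ0 ≤ sg F z s := (Real.log_le_log_iff hσpos (by linarith)).1 hlogge
  have hlog1 : 1 < Real.log σ0 := by rwa [Real.lt_log_iff_exp_lt hσpos]
  have hll : 0 < Real.log (Real.log (sg F z s)) := Real.log_pos (by linarith)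
  have hHpos : 0 < H := by change c.Λs ≤ H at hH; linarith
  have hL5 : 1 ≤ Real.log (c.a + 1) := by
    rw [Real.le_log_iff_exp_le (by linarith)]
    have := Real.exp_one_lt_d9; linarith
  have hupper : Real.log (Real.log (sg F z s)) ≤ 2 * Real.log (c.a + 1) * (√H + n) := by
    have e1 : Real.log (sg F z s) ≤ H * (c.a + 1) ^ n := by
      have := p.nonneg s
      have := p.nonneg (s + 1)
      refine le_trans ?_ hbd
      linarith
    refine (Real.log_le_log (by linarith) e1).trans ?_
    rw [Real.log_mul hHpos.ne' (by positivity), Real.log_pow]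
    have e2 : Real.log H ≤ 2 * √H := by
      have : Real.log H = 2 * Real.log (√H) := by
        rw [Real.log_sqrt hHpos.le]; ring
      rw [this]
      have := Real.log_le_sub_one_of_pos (Real.sqrt_pos.2 hHpos)
      linarith
    have e3 : 0 ≤ √H := Real.sqrt_nonneg _
    have e4 : (0:ℝ) ≤ n := Nat.cast_nonneg _
    nlinarith
  refine le_trans ?_ (hS _ hσ)
  have hq : 0 < √H + n := by
    have e3 : 0 < √H := Real.sqrt_pos.2 hHpos
    positivity
  rw [div_le_div_iff₀ hq hll]
  calc α * Real.log (Real.log (sg F z s)) ≤ α * (2 * Real.log (c.a + 1) * (√H + n)) :=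
        mul_le_mul_of_nonneg_left hupper hα.le
    _ = (α * (2 * Real.log (c.a + 1))) * (√H + n) := by ring
    _ ≤ c1 * (√H + n) := mul_le_mul_of_nonneg_right hαc hq.le

/-- the bound for the potential after one step -/
def Phi (c : Cst) (α K : ℝ) (S : Set ℝ) (x : ((ℕ × ℝ × ℕ) × ℝ × ℝ) × ℝ) : ℝ :=
  open Classical in
  x.1.1.1 + psi α K x.1.2.1 +
      (if x.1.1.2.2 = 0 then 0 else
        if c.N ≤ x.1.1.2.2 ∧ (|x.2| ≤ 1 ∧ x.1.2.2 * x.2 ∈ S) then 0 else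
          price c α x.1.1.2.1 (x.1.1.2.2 + 1))

lemma meas_Phi (c : Cst) (α K : ℝ) {S : Set ℝ} (hS : MeasurableSet S) :
    Measurable (Phi c α K S) := by
  classical
  unfold Phi psi price qq
  have hm : Measurable (fun n : ℕ => max (((n + 1 : ℕ)) : ℝ) (c.N : ℝ)) := measurable_of_countable _
  have hm2 : Measurable (fun n : ℕ => (n : ℝ)) := measurable_of_countable _
  have hn : Measurable (fun x : ((ℕ × ℝ × ℕ) × ℝ × ℝ) × ℝ => x.1.1.2.2) := by fun_prop
  have hb : Measurable (fun x : ((ℕ × ℝ × ℕ) × ℝ × ℝ) × ℝ => (x.1.1.1 : ℝ)) :=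
    hm2.comp (by fun_prop : Measurable (fun x : ((ℕ × ℝ × ℕ) × ℝ × ℝ) × ℝ => x.1.1.1))
  have hmn := hm.comp hn
  refine (hb.add (by fun_prop)).add (Measurable.ite ?_ measurable_const
    (Measurable.ite ?_ measurable_const ?_))
  · exact hn (measurableSet_singleton 0)
  · refine MeasurableSet.inter (hn (measurableSet_Ici (a := c.N))) (MeasurableSet.inter ?_ ?_)
    · have h0 : Measurable (fun x : ((ℕ × ℝ × ℕ) × ℝ × ℝ) × ℝ => |x.2|) := by fun_prop
      exact measurableSet_le h0 measurable_const
    · have : Measurable (fun x : ((ℕ × ℝ × ℕ) × ℝ × ℝ) × ℝ => x.1.2.2 * x.2) := by fun_prop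
      exact this hS
  · have h1 : Measurable (fun x : ((ℕ × ℝ × ℕ) × ℝ × ℝ) × ℝ => √ x.1.1.2.1) := by fun_prop
    have h2 : Measurable (fun x : ((ℕ × ℝ × ℕ) × ℝ × ℝ) × ℝ => c.η * x.1.1.2.1) := by fun_prop
    exact ((h1.add hmn).div h2).pow_const α

lemma lint_Phi {c : Cst} {α K : ℝ} {S : Set ℝ} (hα : 0 < α) (hα1 : α ≤ 1) (hK : 0 ≤ K)
    (hSm : MeasurableSet S)
    (B n : ℕ) (H l σ : ℝ) (hH : n ≠ 0 → 0 < H)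
    (hhit : c.N ≤ n → α / (√H + n) ≤ gam.real {u | |u| ≤ 1 ∧ σ * u ∈ S}) :
    ∫⁻ u, ENNReal.ofReal (Phi c α K S (((B, H, n), l, σ), u)) ∂gam ≤
      ENNReal.ofReal (B + UU c α (B, H, n) + psi α K l) := by
  classical
  have hpsi := psi_nonneg (α := α) (x := l) hK
  have hBp : (0:ℝ) ≤ B := Nat.cast_nonneg _
  by_cases hn0 : n = 0
  · subst hn0
    simp [Phi, UU]
  have hHp := hH hn0
  have hpr := fun k => price_nonneg c (α := α) hHp.le k
  rcases Nat.lt_or_ge n c.N with hlt | hge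
  · have : ¬ c.N ≤ n := by omega
    simp only [Phi, hn0, if_false, this, false_and, UU]
    rw [price_succ_small c hlt]
    rw [lintegral_const]
    simp only [measure_univ, mul_one]
    apply ENNReal.ofReal_le_ofReal
    linarith
  · set A : Set ℝ := {u | |u| ≤ 1 ∧ σ * u ∈ S} with hA
    have hAm : MeasurableSet A := by
      refine MeasurableSet.inter (measurableSet_le
        (by fun_prop : Measurable (fun u : ℝ => |u|)) measurable_const) ?_
      exact (measurable_const_mul σ) hSm
    have hp := hhit hge
    have key : ∀ u, ENNReal.ofReal (Phi c α K S (((B, H, n), l, σ), u)) =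
        ENNReal.ofReal (B + psi α K l) + Aᶜ.indicator
          (fun _ => ENNReal.ofReal (price c α H (n + 1))) u := by
      intro u
      by_cases hu : u ∈ A
      · have hu' : |u| ≤ 1 ∧ σ * u ∈ S := hu
        simp [Phi, hn0, hge, hu', hu]
      · have hu' : ¬ (|u| ≤ 1 ∧ σ * u ∈ S) := hu
        simp only [Phi, hn0, hge, hu', if_false, true_and]
        rw [Set.indicator_of_mem (by exact hu), ENNReal.ofReal_add (by positivity) (hpr _)]
    simp_rw [key]
    rw [lintegral_add_left measurable_const, lintegral_const, lintegral_indicator hAm.compl,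
      setLIntegral_const]
    simp only [measure_univ, mul_one, UU, hn0, if_false]
    have e1 : gam Aᶜ = ENNReal.ofReal (1 - gam.real A) := by
      rw [← probReal_compl_eq_one_sub hAm, ofReal_measureReal]
    have hAle : gam.real A ≤ 1 := measureReal_le_one
    rw [e1, ← ENNReal.ofReal_mul (hpr _), ← ENNReal.ofReal_add (by positivity)
      (mul_nonneg (hpr _) (by linarith))]
    apply ENNReal.ofReal_le_ofReal
    have h2 := price_succ c hα hα1 hHp hge
    have hq : 0 < √H + n := by
      have e3 : 0 < √H := Real.sqrt_pos.2 hHp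
      positivity
    set r := α / (√H + n) with hr
    have hr0 : 0 ≤ r := by positivity
    have h3 : price c α H (n + 1) * (1 - gam.real A) ≤ price c α H n := by
      calc _ ≤ (price c α H n * (1 + r)) * (1 - gam.real A) :=
            mul_le_mul_of_nonneg_right h2 (by linarith)
        _ ≤ (price c α H n * (1 + r)) * (1 - r) := by
            apply mul_le_mul_of_nonneg_left (by linarith)
            have := hpr n
            positivity
        _ = price c α H n * (1 - r ^ 2) := by ring
        _ ≤ price c α H n := by nlinarith [hpr n, mul_nonneg (hpr n) (sq_nonneg r)]
    linarith

lemma lint_VV_succ {c : Cst} {F : ℝ → ℝ} {S : Set ℝ} {y₀ : ℝ} {y : ℕ → Ω → ℝ} {α K c1 σ0 : ℝ}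
    (M : Model P F y₀ y)
    (hp : ∀ z, Path c (lam F z) (EE c F z) (Hit F S z)) (hSm : MeasurableSet S)
    (hS : HitProb S c1 σ0)
    (hα : 0 < α) (hα1 : α ≤ 1) (hαc : α * (2 * Real.log (c.a + 1)) ≤ c1) (hσ0 : Real.exp 1 < σ0)
    (hΛσ : Real.log σ0 ≤ (c.ρ₀ - 1) * c.Λs / 2) (hK : 0 ≤ K)
    (hKc : K + (2 / c.η) ^ α ≤ K * c.ρ₀ ^ (α / 2)) (s : ℕ) :
    ∫⁻ ω, ENNReal.ofReal (VV c α K (lam F fun i => y i ω) (EE c F fun i => y i ω) (s + 1)) ∂P ≤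
    ∫⁻ ω, ENNReal.ofReal (VV c α K (lam F fun i => y i ω) (EE c F fun i => y i ω) s) ∂P := by
  set X : Ω → (ℕ × ℝ × ℕ) × ℝ × ℝ := fun ω =>
    (st c (lam F fun i => y i ω) (EE c F fun i => y i ω) s,
      lam F (fun i => y i ω) (s + 1), sg F (fun i => y i ω) s) with hXdef
  set e : Ω → ℝ := fun ω => ee F (fun i => y i ω) (s + 1)
  have hmF := M.mF
  have hXm : Measurable[MeasurableSpace.comap (fun ω (i : Fin (s + 1)) => y i ω) inferInstance] X := by
    set m := MeasurableSpace.comap (fun ω (i : Fin (s + 1)) => y i ω) inferInstance with hm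
    have hT : Measurable[m] (fun ω (i : Fin (s + 1)) => y i ω) := comap_measurable _
    have hy : ∀ i < s + 1, Measurable[m] (y i) := fun i hi =>
      (measurable_pi_apply (⟨i, hi⟩ : Fin (s + 1))).comp hT
    exact (meas_st hmF c hy).prodMk ((meas_lam hmF hy).prodMk (meas_sg hmF hy))
  have hle : MeasurableSpace.comap (fun ω (i : Fin (s + 1)) => y i ω) inferInstance ≤
      (inferInstance : MeasurableSpace Ω) :=
    (measurable_pi_lambda _ fun i : Fin (s + 1) => M.my i).comap_le
  have hXm' : Measurable X := hXm.mono hle le_rfl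
  have hem : Measurable e := meas_ee M.mF (fun i _ => M.my i)
  have hind : IndepFun X e P := by
    have h := M.ind s
    rw [IndepFun_iff_Indep] at h ⊢
    exact indep_of_indep_of_le_left h (measurable_iff_comap_le.1 hXm)
  calc _ ≤ ∫⁻ ω, ENNReal.ofReal (Phi c α K S (X ω, e ω)) ∂P := by
        apply lintegral_mono
        intro ω
        apply ENNReal.ofReal_le_ofReal
        have key := (hp fun i => y i ω).VV_succ hα hK hKc s
        by_cases h1 : (st c (lam F fun i => y i ω) (EE c F fun i => y i ω) s).2.2 = 0
        · rw [if_pos h1] at key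
          simp only [Phi, hXdef, h1, if_true]
          exact key
        · rw [if_neg h1] at key
          by_cases h2 : c.N ≤ (st c (lam F fun i => y i ω) (EE c F fun i => y i ω) s).2.2 ∧
            Hit F S (fun i => y i ω) (s + 1)
          · rw [if_pos h2] at key
            have h2' : c.N ≤ (X ω).1.2.2 ∧ (|e ω| ≤ 1 ∧ (X ω).2.2 * e ω ∈ S) := h2
            have h1' : ¬ (X ω).1.2.2 = 0 := h1
            unfold Phi
            rw [if_neg h1', if_pos h2']
            exact key
          · rw [if_neg h2] at key
            have h2' : ¬ (c.N ≤ (X ω).1.2.2 ∧ (|e ω| ≤ 1 ∧ (X ω).2.2 * e ω ∈ S)) := h2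
            have h1' : ¬ (X ω).1.2.2 = 0 := h1
            unfold Phi
            rw [if_neg h1', if_neg h2']
            exact key
    _ = ∫⁻ ω, ∫⁻ u, ENNReal.ofReal (Phi c α K S (X ω, u)) ∂gam ∂P :=
        tonelli hXm' hem hind (M.law s) (meas_Phi c α K hSm).ennreal_ofReal
    _ ≤ _ := by
        apply lintegral_mono
        intro ω
        have I := (hp fun i => y i ω).inv s
        refine lint_Phi hα hα1 hK hSm _ _ _ _ _ ?_ ?_
        · intro hn
          have := I.ht (Nat.one_le_iff_ne_zero.2 hn)
          have h8 := c.Λs_pos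
          linarith
        · intro hn
          exact hit_ge (hp fun i => y i ω) hS hα hαc hσ0 hΛσ s hn

lemma st_mono (c : Cst) (Λ E : ℕ → ℝ) (s : ℕ) : (st c Λ E s).1 ≤ (st c Λ E (s + 1)).1 := by
  simp only [st]
  split_ifs <;> simp

theorem bounded_cash {c : Cst} {F : ℝ → ℝ} {S : Set ℝ} {y₀ : ℝ} {y : ℕ → Ω → ℝ} {α K c1 σ0 : ℝ}
    (M : Model P F y₀ y)
    (hp : ∀ z, Path c (lam F z) (EE c F z) (Hit F S z)) (hSm : MeasurableSet S)
    (hS : HitProb S c1 σ0)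
    (hα : 0 < α) (hα1 : α ≤ 1) (hαc : α * (2 * Real.log (c.a + 1)) ≤ c1) (hσ0 : Real.exp 1 < σ0)
    (hΛσ : Real.log σ0 ≤ (c.ρ₀ - 1) * c.Λs / 2) (hK : 0 ≤ K)
    (hKc : K + (2 / c.η) ^ α ≤ K * c.ρ₀ ^ (α / 2)) :
    ∀ᵐ ω ∂P, ∃ m : ℕ, ∀ s, (st c (lam F fun i => y i ω) (EE c F fun i => y i ω) s).1 ≤ m := by
  set V0 := ∫⁻ ω, ENNReal.ofReal
    (VV c α K (lam F fun i => y i ω) (EE c F fun i => y i ω) 0) ∂P with hV0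
  have hV0fin : V0 < ⊤ := by
    have : ∀ ω, VV c α K (lam F fun i => y i ω) (EE c F fun i => y i ω) 0 =
        VV c α K (lam F fun _ => y₀) (EE c F fun _ => y₀) 0 := by
      intro ω
      have h1 : lam F (fun i => y i ω) 1 = lam F (fun _ => y₀) 1 := by
        simp [lam, RR, M.y0]
      have h0 : lam F (fun i => y i ω) 0 = lam F (fun _ => y₀) 0 := by
        simp [lam, RR]
      simp only [VV, st, Jump, zero_add, h1, h0]
    rw [hV0]
    simp_rw [this]
    simp
  have hV : ∀ s, ∫⁻ ω, ENNReal.ofReal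
      (VV c α K (lam F fun i => y i ω) (EE c F fun i => y i ω) s) ∂P ≤ V0 := by
    intro s
    induction s with
    | zero => exact le_rfl
    | succ s ih => exact (lint_VV_succ M hp hSm hS hα hα1 hαc hσ0 hΛσ hK hKc s).trans ih
  set Bf : ℕ → Ω → ENNReal := fun s ω =>
    ((st c (lam F fun i => y i ω) (EE c F fun i => y i ω) s).1 : ENNReal) with hBf
  have hBm : ∀ s, Measurable (Bf s) := by
    intro s
    have := (meas_st M.mF c (s := s) (fun i _ => M.my i)).fst
    exact (measurable_of_countable (fun n : ℕ => (n : ENNReal))).comp this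
  have hmono : Monotone Bf := by
    apply monotone_nat_of_le_succ
    intro s ω
    simp only [hBf]
    exact_mod_cast st_mono c _ _ s
  have hBV : ∀ s, ∫⁻ ω, Bf s ω ∂P ≤ V0 := by
    intro s
    refine le_trans (lintegral_mono fun ω => ?_) (hV s)
    have I := (hp fun i => y i ω).inv s
    have h8 := c.Λs_pos
    have hU : 0 ≤ UU c α (st c (lam F fun i => y i ω) (EE c F fun i => y i ω) s) := by
      unfold UU
      split_ifs with h
      · exact le_rfl
      · exact price_nonneg c (by have := I.ht (by omega); linarith) _
    have hpsi := psi_nonneg (α := α) (x := lam F (fun i => y i ω) (s + 1)) hK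
    simp only [hBf]
    rw [← ENNReal.ofReal_natCast]
    apply ENNReal.ofReal_le_ofReal
    unfold VV
    linarith
  have hsup : ∫⁻ ω, ⨆ s, Bf s ω ∂P ≤ V0 := by
    rw [lintegral_iSup hBm hmono]
    exact iSup_le hBV
  have hae := ae_lt_top (Measurable.iSup hBm) (lt_of_le_of_lt hsup hV0fin).ne
  filter_upwards [hae] with ω hω
  obtain ⟨m, hm⟩ := ENNReal.exists_nat_gt hω.ne
  refine ⟨m, fun s => ?_⟩
  have h1 : Bf s ω ≤ m := (le_iSup (fun s => Bf s ω) s).trans hm.le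
  simp only [hBf] at h1
  exact_mod_cast h1

end Stab

end

-- part C3
noncomputable section
namespace Stab

lemma gam_lower {A : Set ℝ} (hA : MeasurableSet A) (hsub : ∀ u ∈ A, |u| ≤ 1) :
    gaussianPDFReal 0 1 1 * (volume A).toReal ≤ gam.real A := by
  have hfin : volume A < ⊤ := by
    refine lt_of_le_of_lt (measure_mono (t := Set.Icc (-1) 1) fun u hu => ?_) (by simp)
    exact abs_le.1 (hsub u hu)
  have h : ENNReal.ofReal (gaussianPDFReal 0 1 1) * volume A ≤ gam A := by
    rw [gaussianReal_apply 0 (by norm_num) A, ← setLIntegral_const]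
    apply setLIntegral_mono' hA
    intro u hu
    unfold gaussianPDF
    apply ENNReal.ofReal_le_ofReal
    unfold gaussianPDFReal
    have hu2 : u ^ 2 ≤ 1 := by
      rw [← sq_abs]; have := hsub u hu; have := abs_nonneg u; nlinarith
    apply mul_le_mul_of_nonneg_left _ (by positivity)
    apply Real.exp_le_exp.2
    simp only [sub_zero, NNReal.coe_one]
    linarith
  have h2 := ENNReal.toReal_mono (measure_ne_top _ _) h
  rw [ENNReal.toReal_mul, ENNReal.toReal_ofReal (gaussianPDFReal_nonneg _ _ _)] at h2
  exact h2

lemma hitProb_of_liminf {S : Set ℝ} (hS : MeasurableSet S)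
    (h : (0 : EReal) < Filter.liminf (fun l : ℝ =>
      (((volume (S ∩ Set.Icc (-l) l)).toReal / l *
        Real.log (Real.log l) : ℝ) : EReal)) Filter.atTop) :
    ∃ c1 σ0 : ℝ, 0 < c1 ∧ Real.exp 1 < σ0 ∧ HitProb S c1 σ0 := by
  obtain ⟨c0, hc0, hc0'⟩ := EReal.lt_iff_exists_real_btwn.1 h
  have hev := eventually_lt_of_lt_liminf hc0'
  have hc0p : 0 < c0 := by exact_mod_cast hc0
  obtain ⟨l0, hl0⟩ := eventually_atTop.1 hev
  have hφ : 0 < gaussianPDFReal 0 1 1 := gaussianPDFReal_pos _ _ _ (by norm_num)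
  refine ⟨gaussianPDFReal 0 1 1 * c0, max l0 (Real.exp 2), by positivity, ?_, ?_⟩
  · exact lt_of_lt_of_le (Real.exp_lt_exp.2 (by norm_num)) (le_max_right _ _)
  · intro σ hσ
    have h1 : l0 ≤ σ := (le_max_left _ _).trans hσ
    have h2 : Real.exp 2 ≤ σ := (le_max_right _ _).trans hσ
    have hσp : 0 < σ := lt_of_lt_of_le (Real.exp_pos _) h2
    have h3 := hl0 σ h1
    have h3' : c0 < (volume (S ∩ Set.Icc (-σ) σ)).toReal / σ * Real.log (Real.log σ) := by
      exact_mod_cast h3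
    have hlog : 2 ≤ Real.log σ := (Real.le_log_iff_exp_le hσp).2 h2
    have hll : 0 < Real.log (Real.log σ) := Real.log_pos (by linarith)
    set A : Set ℝ := {u | |u| ≤ 1 ∧ σ * u ∈ S} with hAdef
    have hA : A = (fun u => σ * u) ⁻¹' (S ∩ Set.Icc (-σ) σ) := by
      ext u
      simp only [hAdef, Set.mem_ofPred_eq, Set.mem_preimage, Set.mem_inter_iff, Set.mem_Icc]
      rw [and_comm, abs_le]
      refine and_congr_right fun _ => ?_
      constructor
      · rintro ⟨h, h'⟩; constructor <;> nlinarith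
      · rintro ⟨h, h'⟩; constructor <;> nlinarith
    have hAm : MeasurableSet A := by
      rw [hA]
      exact (measurable_const_mul σ) (hS.inter measurableSet_Icc)
    have hvol : (volume A).toReal = (volume (S ∩ Set.Icc (-σ) σ)).toReal / σ := by
      rw [hA, Real.volume_preimage_mul_left hσp.ne', ENNReal.toReal_mul,
        ENNReal.toReal_ofReal (abs_nonneg _), abs_of_pos (by positivity)]
      ring
    have hlow := gam_lower hAm (fun u hu => hu.1)
    rw [hvol] at hlow
    refine le_trans ?_ hlow
    rw [mul_div_assoc]
    apply mul_le_mul_of_nonneg_left _ hφ.le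
    rw [div_le_iff₀ hll]
    exact h3'.le

end Stab

end

-- part D1
noncomputable section
namespace Stab

variable {Ω : Type*} [MeasurableSpace Ω] {P : Measure Ω} [IsProbabilityMeasure P]

lemma lint_exp_abs : ∃ C : ENNReal, C ≠ ⊤ ∧ ∫⁻ u, ENNReal.ofReal (Real.exp |u|) ∂gam ≤ C := by
  have h1 : Integrable (fun u : ℝ => Real.exp (1 * u)) gam := integrable_exp_mul_gaussianReal 1
  have h2 : Integrable (fun u : ℝ => Real.exp (-1 * u)) gam := integrable_exp_mul_gaussianReal (-1)
  have h3 := (h1.add h2).lintegral_lt_top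
  refine ⟨_, h3.ne, lintegral_mono fun u => ENNReal.ofReal_le_ofReal ?_⟩
  simp only [Pi.add_apply]
  rcases abs_cases u with ⟨h, _⟩ | ⟨h, _⟩ <;> rw [h]
  · have := Real.exp_pos (-1 * u); simp; positivity
  · have := Real.exp_pos (1 * u); simp; positivity

lemma Model.mee {F : ℝ → ℝ} {y₀ : ℝ} {y : ℕ → Ω → ℝ} (M : Model P F y₀ y) (s : ℕ) :
    Measurable (fun ω => ee F (fun i => y i ω) s) := meas_ee M.mF (fun i _ => M.my i)

lemma Model.log_bound {F : ℝ → ℝ} {y₀ : ℝ} {y : ℕ → Ω → ℝ} (M : Model P F y₀ y) :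
    ∀ᵐ ω ∂P, ∃ C : ℝ, 0 ≤ C ∧ ∀ s : ℕ, |ee F (fun i => y i ω) s| ≤ C + 2 * Real.log (s + 1) := by
  obtain ⟨C, hC, hCb⟩ := lint_exp_abs
  have hbound : ∀ s : ℕ, P {ω | 2 * Real.log (s + 1) ≤ |ee F (fun i => y i ω) (s + 1)|} ≤
      C * ENNReal.ofReal (1 / ((s:ℝ) + 1) ^ 2) := by
    intro s
    have e1 : P {ω | 2 * Real.log (s + 1) ≤ |ee F (fun i => y i ω) (s + 1)|} =
        gam {u | 2 * Real.log (s + 1) ≤ |u|} := by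
      rw [← M.law s, Measure.map_apply (M.mee _)
        (measurableSet_le measurable_const (by fun_prop : Measurable (fun u : ℝ => |u|)))]
      rfl
    have hs : (0:ℝ) < s + 1 := by positivity
    have e2 : {u : ℝ | 2 * Real.log (s + 1) ≤ |u|} ⊆
        {u | ENNReal.ofReal (((s:ℝ) + 1) ^ 2) ≤ ENNReal.ofReal (Real.exp |u|)} := by
      intro u hu
      apply ENNReal.ofReal_le_ofReal
      have := Real.exp_le_exp.2 hu
      rwa [mul_comm, Real.exp_mul, Real.exp_log hs, Real.rpow_two] at this
    rw [e1]
    refine (measure_mono e2).trans ?_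
    refine (meas_ge_le_lintegral_div (by fun_prop) (by simp; positivity) (by simp)).trans ?_
    rw [one_div, ENNReal.ofReal_inv_of_pos (by positivity), ENNReal.div_eq_inv_mul, mul_comm]
    gcongr
  have hsum : ∑' s : ℕ, P {ω | 2 * Real.log (s + 1) ≤ |ee F (fun i => y i ω) (s + 1)|} ≠ ⊤ := by
    refine ne_top_of_le_ne_top ?_ (ENNReal.tsum_le_tsum hbound)
    rw [ENNReal.tsum_mul_left]
    refine ENNReal.mul_ne_top hC ?_
    have hsm : Summable (fun s : ℕ => 1 / ((s:ℝ) + 1) ^ 2) := by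
      have := (summable_nat_add_iff 1).2 (Real.summable_one_div_nat_pow.2 (by norm_num : 1 < 2))
      simpa using this
    rw [← ENNReal.ofReal_tsum_of_nonneg (fun s => by positivity) hsm]
    exact ENNReal.ofReal_ne_top
  filter_upwards [ae_eventually_notMem hsum] with ω hω
  obtain ⟨n, hn⟩ := eventually_atTop.1 hω
  refine ⟨∑ s ∈ Finset.range (n + 1), |ee F (fun i => y i ω) s|,
    Finset.sum_nonneg fun _ _ => abs_nonneg _, fun s => ?_⟩
  have hlog : 0 ≤ Real.log ((s:ℝ) + 1) := Real.log_nonneg (by simp)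
  rcases Nat.lt_or_ge s (n + 1) with h | h
  · have := Finset.single_le_sum (f := fun s => |ee F (fun i => y i ω) s|)
      (fun _ _ => abs_nonneg _) (Finset.mem_range.2 h)
    linarith
  · obtain ⟨k, rfl⟩ : ∃ k, s = k + 1 := ⟨s - 1, by omega⟩
    have h1 := hn k (by omega)
    simp only [not_le] at h1
    have h2 : Real.log ((k:ℝ) + 1) ≤ Real.log (((k + 1 : ℕ):ℝ) + 1) := by
      apply Real.log_le_log (by positivity); push_cast; linarith
    have h3 : 0 ≤ ∑ s ∈ Finset.range (n + 1), |ee F (fun i => y i ω) s| :=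
      Finset.sum_nonneg fun _ _ => abs_nonneg _
    linarith

lemma Model.indep {F : ℝ → ℝ} {y₀ : ℝ} {y : ℕ → Ω → ℝ} (M : Model P F y₀ y) {i j : ℕ}
    (h : i < j) : IndepFun (fun ω => ee F (fun k => y k ω) (i + 1))
      (fun ω => ee F (fun k => y k ω) (j + 1)) P := by
  have hi := M.ind j
  have hmF := M.mF
  rw [IndepFun_iff_Indep] at hi ⊢
  refine indep_of_indep_of_le_left hi (measurable_iff_comap_le.1 ?_)
  set m := MeasurableSpace.comap (fun ω (i : Fin (j + 1)) => y i ω) inferInstance with hm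
  have hT : Measurable[m] (fun ω (i : Fin (j + 1)) => y i ω) := comap_measurable _
  have hy : ∀ i < j + 1, Measurable[m] (y i) := fun i hi =>
    (measurable_pi_apply (⟨i, hi⟩ : Fin (j + 1))).comp hT
  exact meas_ee hmF (fun k hk => hy k (by omega))

lemma Model.slln {F : ℝ → ℝ} {y₀ : ℝ} {y : ℕ → Ω → ℝ} (M : Model P F y₀ y) :
    ∀ᵐ ω ∂P, ∃ C : ℝ, 0 ≤ C ∧ ∀ t : ℕ,
      ∑ i ∈ Finset.range t, ee F (fun k => y k ω) (i + 1) ^ 2 ≤ C * t := by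
  have hid : ∀ i, IdentDistrib (fun ω => ee F (fun k => y k ω) (i + 1))
      (fun ω => ee F (fun k => y k ω) (0 + 1)) P P := fun i =>
    ⟨(M.mee _).aemeasurable, (M.mee _).aemeasurable, by rw [M.law, M.law]⟩
  have hinteg : Integrable (fun ω => ee F (fun k => y k ω) (0 + 1) ^ 2) P := by
    have h1 : MemLp id 2 gam := memLp_id_gaussianReal 2
    have h2 : Integrable (fun u : ℝ => u ^ 2) gam := h1.integrable_sq
    rw [← M.law 0] at h2
    exact (integrable_map_measure (by fun_prop) (M.mee _).aemeasurable).1 h2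
  have hsq : Measurable (fun u : ℝ => u ^ 2) := by fun_prop
  have := strong_law_ae_real (fun i ω => ee F (fun k => y k ω) (i + 1) ^ 2) hinteg ?_ ?_
  · filter_upwards [this] with ω hω
    obtain ⟨C, hC⟩ := hω.bddAbove_range
    refine ⟨max C 0, le_max_right _ _, fun t => ?_⟩
    rcases Nat.eq_zero_or_pos t with rfl | ht
    · simp
    · have h1 := hC ⟨t, rfl⟩
      simp only at h1
      have ht' : (0:ℝ) < t := by exact_mod_cast ht
      rw [div_le_iff₀ ht'] at h1
      exact h1.trans (mul_le_mul_of_nonneg_right (le_max_left _ _) ht'.le)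
  · intro i j hij
    rcases lt_or_gt_of_ne hij with h | h
    · exact (M.indep h).comp hsq hsq
    · exact ((M.indep h).comp hsq hsq).symm
  · intro i
    exact (hid i).comp hsq

end Stab

end

-- part D2
noncomputable section
namespace Stab

variable {c : Cst} {Λ E : ℕ → ℝ} {hit : ℕ → Prop}

/-- slow growth of heights at fresh times -/
lemma Path.fresh_le (p : Path c Λ E hit) {s : ℕ} (h : Fresh c Λ E (s + 1)) :
    Λ (s + 2) ≤ (c.a / c.δ + 1) * E (s + 1) := by
  unfold Fresh at h
  have hδ := c.hδ
  have ha := c.ha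
  have hE := p.hE (s + 1)
  have h2 := c.hΛ2
  have hl2 : 0 < Real.log 2 := Real.log_pos (by norm_num)
  have hE0 : 0 < E (s + 1) := by linarith
  have h1 : Λ (s + 1) ≤ E (s + 1) / c.δ := by rw [le_div_iff₀ hδ]; linarith
  have h0 := p.nonneg s
  have e : (c.a / c.δ + 1) * E (s + 1) = c.a * (E (s + 1) / c.δ) + E (s + 1) := by ring
  have hpos : 0 < E (s + 1) / c.δ := by positivity
  rw [e]
  rcases p.step s with h3 | h3 <;> nlinarith

lemma st_nonneg (p : Path c Λ E hit) (s : ℕ) : 0 ≤ (st c Λ E s).2.1 := by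
  induction s with
  | zero => simp only [st]; split_ifs; exacts [p.nonneg 1, zero_le_one]
  | succ s ih =>
    simp only [st]
    split_ifs
    exacts [p.nonneg _, p.nonneg _, ih, ih]

set_option maxHeartbeats 1000000 in
lemma dbl_or_slow (p : Path c Λ E hit) {m : ℕ} (hm : ∀ s, (st c Λ E s).1 ≤ m)
    {X : ℕ → ℝ} (hX1 : ∀ s, 1 ≤ X s) (hXm : Monotone X)
    (hE : ∀ s, E s ≤ c.δ * c.Λs + 2 * c.a * Real.log (X s))
    (hη : c.η * (2 * c.a * (c.a / c.δ + 1)) * (1 + Real.log (c.a + 1)) ≤ 1 / 2) :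
    ∃ C : ℝ, ∀ s, Λ (s + 1) ≤ Λ s + Real.log 2 ∨ Λ (s + 1) ≤ C * √(X s) := by
  have ha := c.ha
  have hδ := c.hδ
  have h8 := c.Λs_pos
  have hηp := c.hη
  have hl2 : 0 < Real.log 2 := Real.log_pos (by norm_num)
  have hmono : Monotone fun s => (st c Λ E s).1 := monotone_nat_of_le_succ (st_mono c Λ E)
  have hΛm : Monotone Λ := monotone_nat_of_le_succ p.mono
  obtain ⟨s1, hs1⟩ : ∃ s1, ∀ s, s1 ≤ s → (st c Λ E s).1 = (st c Λ E s1).1 := by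
    obtain ⟨v, ⟨s1, rfl⟩, hv⟩ := (Set.finite_le_nat m).subset
      (by rintro _ ⟨s, rfl⟩; exact hm s : Set.range (fun s => (st c Λ E s).1) ⊆ {n | n ≤ m})
      |>.exists_maximal (Set.range_nonempty _)
    refine ⟨s1, fun s hs => le_antisymm (hv ⟨s, rfl⟩ (hmono hs)) (hmono hs)⟩
  have hlX : ∀ s, 0 ≤ Real.log (X s) := fun s => Real.log_nonneg (hX1 s)
  have hlXm : ∀ s, Real.log (X s) ≤ Real.log (X (s + 1)) := fun s =>
    Real.log_le_log (by linarith [hX1 s]) (hXm (Nat.le_succ s))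
  set K2 := 2 * c.a * (c.a / c.δ + 1) with hK2
  have hK2p : 0 < K2 := by positivity
  set K1 := (c.a / c.δ + 1) * (c.δ * c.Λs) with hK1
  have hK1p : 0 < K1 := by positivity
  have hfr : ∀ s, Fresh c Λ E (s + 1) → Λ (s + 2) ≤ K1 + K2 * Real.log (X (s + 1)) := by
    intro s h
    refine (p.fresh_le h).trans ?_
    have := mul_le_mul_of_nonneg_left (hE (s + 1)) (by positivity : 0 ≤ c.a / c.δ + 1)
    refine this.trans (le_of_eq ?_)
    rw [hK1, hK2]; ring
  set H1 := (st c Λ E s1).2.1 with hH1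
  set n1 := (st c Λ E s1).2.2 with hn1
  have hH1p : 0 ≤ H1 := st_nonneg p s1
  -- heights and lengths
  have hst : ∀ k, (st c Λ E (s1 + k)).2.1 ≤ H1 + K1 + K2 * Real.log (X (s1 + k)) ∧
      ((st c Λ E (s1 + k)).2.2 : ℝ) ≤ n1 + 1 + c.η * (st c Λ E (s1 + k)).2.1 := by
    intro k
    induction k with
    | zero =>
      constructor
      · have := mul_nonneg hK2p.le (hlX (s1 + 0))
        change H1 ≤ _
        linarith
      · change (n1:ℝ) ≤ n1 + 1 + c.η * H1
        have : 0 ≤ c.η * H1 := by positivity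
        linarith
    | succ k ih =>
      have hmul := mul_le_mul_of_nonneg_left (hlXm (s1 + k)) hK2p.le
      have hB := (hs1 (s1 + (k + 1)) (by omega)).trans (hs1 (s1 + k) (by omega)).symm
      have hnn := st_nonneg p (s1 + k)
      have hn1' : (0:ℝ) ≤ n1 := Nat.cast_nonneg _
      rw [← add_assoc] at hB ⊢
      by_cases hj : Jump c Λ (s1 + k + 1)
      · by_cases hf : Fresh c Λ E (s1 + k + 1)
        · simp only [st, hj, hf, if_true]
          refine ⟨?_, ?_⟩
          · have := hfr _ hf; linarith
          · have : 0 ≤ c.η * Λ (s1 + k + 2) := mul_nonneg hηp.le (p.nonneg _)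
            push_cast
            linarith
        · by_cases hq : c.η * (st c Λ E (s1 + k)).2.1 ≤
            qq c (st c Λ E (s1 + k)).2.1 ((st c Λ E (s1 + k)).2.2 + 1)
          · simp only [st, hj, hf, if_true, if_false, hq] at hB
            omega
          · simp only [st, hj, hf, if_true, if_false, hq]
            refine ⟨by linarith [ih.1], ?_⟩
            push Not at hq
            unfold qq at hq
            have h1 := le_max_left ((((st c Λ E (s1 + k)).2.2 + 1 : ℕ)) : ℝ) (c.N : ℝ)
            have h2 := Real.sqrt_nonneg (st c Λ E (s1 + k)).2.1
            linarith
      · simp only [st, hj, if_false]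
        refine ⟨by linarith [ih.1], ?_⟩
        have : 0 ≤ c.η * (st c Λ E (s1 + k)).2.1 := by positivity
        push_cast
        linarith
  set l := Real.log (c.a + 1) with hl
  have hlp : 0 < l := Real.log_pos (by linarith)
  set C3 := 1 / c.η * Real.exp ((n1 + 1) * l) * Real.exp (c.η * (1 + l) * (H1 + K1)) with hC3
  have hC3p : 0 < C3 := by positivity
  have hXsq : ∀ s, 1 ≤ √(X s) := fun s => by
    rw [Real.le_sqrt' one_pos]; simpa using hX1 s
  have hjump : ∀ s, s1 ≤ s → Jump c Λ s → Λ (s + 1) ≤ C3 * √(X s) := by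
    intro s hs hj
    obtain ⟨k, rfl⟩ := Nat.exists_eq_add_of_le hs
    have I := p.inv (s1 + k)
    have hn := I.pos_iff.2 hj
    obtain ⟨b1, b2⟩ := hst k
    have hnn := st_nonneg p (s1 + k)
    refine (I.bd hn).trans ?_
    set H := (st c Λ E (s1 + k)).2.1
    set n := (st c Λ E (s1 + k)).2.2
    have e1 : (c.a + 1) ^ n = Real.exp (n * l) := by
      rw [mul_comm, Real.exp_mul, hl, Real.exp_log (by linarith), Real.rpow_natCast]
    have e2 : H ≤ 1 / c.η * Real.exp (c.η * H) := by
      have := Real.add_one_le_exp (c.η * H)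
      rw [one_div, ← div_eq_inv_mul, le_div_iff₀ hηp]
      linarith
    have e3 : Real.exp (n * l) ≤ Real.exp ((n1 + 1 + c.η * H) * l) :=
      Real.exp_le_exp.2 (mul_le_mul_of_nonneg_right b2 hlp.le)
    have hXp : 0 < X (s1 + k) := by linarith [hX1 (s1 + k)]
    have e5 : c.η * (1 + l) * H ≤
        c.η * (1 + l) * (H1 + K1) + 1 / 2 * Real.log (X (s1 + k)) := by
      have h1 := mul_le_mul_of_nonneg_left b1 (by positivity : 0 ≤ c.η * (1 + l))
      have h2 := mul_le_mul_of_nonneg_right hη (hlX (s1 + k))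
      nlinarith
    have e4 : √(X (s1 + k)) = Real.exp (1 / 2 * Real.log (X (s1 + k))) := by
      rw [Real.sqrt_eq_rpow, Real.rpow_def_of_pos hXp, mul_comm]
    rw [e1]
    calc H * Real.exp (n * l) ≤
          (1 / c.η * Real.exp (c.η * H)) * Real.exp ((n1 + 1 + c.η * H) * l) := by gcongr
      _ = 1 / c.η * Real.exp ((n1 + 1) * l) * Real.exp (c.η * (1 + l) * H) := by
          rw [mul_assoc, mul_assoc, ← Real.exp_add, ← Real.exp_add]
          ring_nf
      _ ≤ 1 / c.η * Real.exp ((n1 + 1) * l) * Real.exp (c.η * (1 + l) * (H1 + K1) +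
            1 / 2 * Real.log (X (s1 + k))) := by gcongr
      _ = C3 * √(X (s1 + k)) := by
          rw [Real.exp_add, e4, hC3]; ring
  have hfr2 : ∀ s, Fresh c Λ E (s + 1) → Λ (s + 2) ≤ (K1 + 2 * K2) * √(X (s + 1)) := by
    intro s h
    refine (hfr s h).trans ?_
    have hXp : 0 < X (s + 1) := by linarith [hX1 (s + 1)]
    have e2 : Real.log (X (s + 1)) ≤ 2 * √(X (s + 1)) := by
      have : Real.log (X (s + 1)) = 2 * Real.log (√(X (s + 1))) := by
        rw [Real.log_sqrt hXp.le]; ring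
      rw [this]
      have := Real.log_le_sub_one_of_pos (Real.sqrt_pos.2 hXp)
      linarith
    nlinarith [hXsq (s + 1)]
  set C4 := C3 + (K1 + 2 * K2) + Λ (s1 + 1) with hC4
  have hΛ1 := p.nonneg (s1 + 1)
  have hC4p : 0 < C4 := by positivity
  -- the invariant
  have hsqm : ∀ s, √(X s) ≤ √(X (s + 1)) := fun s => Real.sqrt_le_sqrt (hXm (Nat.le_succ s))
  have key : ∀ k, Λ (s1 + k + 1) ≤ Λ (s1 + k) + Real.log 2 ∨
      ∃ j : ℕ, Λ (s1 + k + 1) ≤ (c.a + 1) ^ j * (C4 * √(X (s1 + k))) ∧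
        (j = 0 ∨ Λ (s1 + k + 1) ≤ (c.ρ₀ - (j - 1) * c.κ) * Λ (s1 + k)) := by
    intro k
    induction k with
    | zero =>
      right
      refine ⟨0, ?_, Or.inl rfl⟩
      have := hXsq (s1 + 0)
      simp only [add_zero, pow_zero, one_mul] at *
      nlinarith
    | succ k ih =>
      rw [← add_assoc]
      have hsq := hXsq (s1 + k + 1)
      by_cases hf : Fresh c Λ E (s1 + k + 1)
      · right
        refine ⟨0, ?_, Or.inl rfl⟩
        have h1 := hfr2 _ hf
        have h2 : (K1 + 2 * K2) * √(X (s1 + k + 1)) ≤ C4 * √(X (s1 + k + 1)) :=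
          mul_le_mul_of_nonneg_right (by linarith) (by linarith)
        rw [pow_zero, one_mul]
        exact h1.trans h2
      by_cases hj : Jump c Λ (s1 + k + 1)
      · right
        refine ⟨0, ?_, Or.inl rfl⟩
        have h1 := hjump _ (by omega) hj
        have h2 : C3 * √(X (s1 + k + 1)) ≤ C4 * √(X (s1 + k + 1)) :=
          mul_le_mul_of_nonneg_right (by linarith) (by linarith)
        rw [pow_zero, one_mul]
        exact h1.trans h2
      have h1 := p.nf hf
      have hA := p.nfA hf
      have hm1 := p.mono (s1 + k + 1)
      have hm0 := p.mono (s1 + k)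
      have hnj : Λ (s1 + k + 2) < c.ρ₀ * Λ (s1 + k + 1) := by
        by_contra hcon
        push Not at hcon
        exact hj ⟨hcon, h1.trans hm1⟩
      rcases p.step (s1 + k) with h2 | h2
      · exact Or.inl h2
      have hE' : E (s1 + k + 1) ≤ c.δ * Λ (s1 + k + 1) := by
        unfold Fresh at hf; linarith
      rcases ih with h3 | ⟨j, h3, h4⟩
      · left
        have hδ2 := c.hδ2
        have hΛa := c.hΛa
        have hlog2 : Real.log 2 ≤ 1 := by
          have := Real.log_two_lt_d9; linarith
        change Λ (s1 + k + 2) ≤ _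
        nlinarith
      · right
        refine ⟨j + 1, ?_, Or.inr ?_⟩
        · calc Λ (s1 + k + 2) ≤ (c.a + 1) * Λ (s1 + k + 1) := hA
            _ ≤ (c.a + 1) * ((c.a + 1) ^ j * (C4 * √(X (s1 + k)))) := by gcongr
            _ ≤ (c.a + 1) * ((c.a + 1) ^ j * (C4 * √(X (s1 + k + 1)))) := by
                gcongr; exact hXm (Nat.le_succ _)
            _ = (c.a + 1) ^ (j + 1) * (C4 * √(X (s1 + k + 1))) := by ring
        · push_cast
          rcases Nat.eq_zero_or_pos j with rfl | hjp
          · simpa using hnj.le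
          · have h4 := h4.resolve_left (by omega)
            have hpos : 0 < Λ (s1 + k + 1) := by linarith
            have hj1 : (1:ℝ) ≤ j := by exact_mod_cast hjp
            set ρ := c.ρ₀ - (j - 1) * c.κ with hρ
            have hΛk := p.nonneg (s1 + k)
            have hΛkp : 0 < Λ (s1 + k) := by
              rcases hΛk.lt_or_eq with h | h
              · exact h
              · rw [← h] at h4; linarith
            have hρ1 : 1 ≤ ρ := by
              by_contra hcon
              push Not at hcon
              have := mul_lt_mul_of_pos_right hcon hΛkp
              linarith
            have hρ0 : ρ ≤ c.ρ₀ := by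
              have := mul_nonneg (sub_nonneg.2 hj1) c.hκ.le
              rw [hρ]; linarith
            have h5 := ratio_step hpos (h2.trans (by linarith :
              c.a * (Λ (s1 + k + 1) - Λ (s1 + k)) + E (s1 + k + 1) ≤
              c.a * (Λ (s1 + k + 1) - Λ (s1 + k)) + c.δ * Λ (s1 + k + 1)))
              (by linarith) (by linarith) h4
            refine h5.trans (mul_le_mul_of_nonneg_right ?_ hpos.le)
            refine (c.hlo ρ hρ1 hρ0).trans (le_of_eq ?_)
            rw [hρ]; ring
  obtain ⟨J, hJ⟩ := exists_nat_gt ((c.ρ₀ - 1) / c.κ + 1)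
  refine ⟨(c.a + 1) ^ J * C4, fun s => ?_⟩
  have hbig : (1:ℝ) ≤ (c.a + 1) ^ J := one_le_pow₀ (by linarith)
  rcases Nat.lt_or_ge s s1 with hs | hs
  · right
    have h1 : Λ (s + 1) ≤ Λ (s1 + 1) := hΛm (by omega)
    have h2 : Λ (s1 + 1) ≤ C4 := by rw [hC4]; linarith
    have h3 := hXsq s
    have h4 : C4 * 1 ≤ (c.a + 1) ^ J * C4 * √(X s) := by
      apply mul_le_mul _ h3 (by norm_num) (by positivity)
      nlinarith
    linarith
  · obtain ⟨k, rfl⟩ := Nat.exists_eq_add_of_le hs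
    rcases key k with h | ⟨j, h3, h4⟩
    · exact Or.inl h
    by_cases hz : Λ (s1 + k + 1) ≤ 0
    · left
      have := p.nonneg (s1 + k)
      linarith
    push Not at hz
    right
    have hjJ : j ≤ J := by
      rcases Nat.eq_zero_or_pos j with rfl | hjp
      · omega
      have h4 := h4.resolve_left (by omega)
      have hm0 := p.mono (s1 + k)
      have hΛk := p.nonneg (s1 + k)
      have hρ1 : 1 ≤ c.ρ₀ - (j - 1) * c.κ := by
        by_contra hcon
        push Not at hcon
        rcases hΛk.lt_or_eq with h | h
        · nlinarith
        · rw [← h] at h4; linarith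
      have hκ := c.hκ
      have : (j:ℝ) ≤ (c.ρ₀ - 1) / c.κ + 1 := by
        have : (j:ℝ) - 1 ≤ (c.ρ₀ - 1) / c.κ := by rw [le_div_iff₀ hκ]; linarith
        linarith
      have : (j:ℝ) < J := by linarith
      exact_mod_cast this.le
    have h5 : (c.a + 1) ^ j ≤ (c.a + 1) ^ J := pow_le_pow_right₀ (by linarith) hjJ
    refine h3.trans ?_
    rw [mul_assoc]
    apply mul_le_mul_of_nonneg_right h5
    positivity

end Stab

end

-- part D3
noncomputable section
namespace Stab

lemma sg_sq_exp (F : ℝ → ℝ) (z : ℕ → ℝ) (s : ℕ) :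
    sg F z s ^ 2 = Real.exp (lam F z (s + 1) - lam F z s) := by
  have h := log_sg F z s
  rw [← h, mul_comm, Real.exp_mul, Real.exp_log (by linarith [sg_ge F z s]), Real.rpow_two]

set_option maxHeartbeats 1000000 in
lemma finish {F : ℝ → ℝ} {z : ℕ → ℝ} {C0 a C C' K : ℝ} (ha : 0 ≤ a) (hC0 : 1 ≤ C0)
    (h1 : ∀ x, |F x| ≤ C0 * (1 + |x|) ^ a) (hC : 0 ≤ C) (hC' : 0 ≤ C')
    (he : ∀ s : ℕ, |ee F z s| ≤ C + 2 * Real.log (s + 1))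
    (hsl : ∀ t : ℕ, ∑ i ∈ Finset.range t, ee F z (i + 1) ^ 2 ≤ C' * t)
    (hd : ∀ s : ℕ, lam F z (s + 1) ≤ lam F z s + Real.log 2 ∨
      lam F z (s + 1) ≤ K * √(1 + C + 2 * Real.log (s + 1))) :
    ∃ M : ℝ, ∀ t : ℕ, 1 ≤ t → (∑ i ∈ Finset.Icc 1 t, (z i) ^ 2) / t ≤ M := by
  have hl2 : 0 < Real.log 2 := Real.log_pos (by norm_num)
  have hlam0 : ∀ s, 0 ≤ lam F z s := fun s => Real.log_nonneg (RR_ge F z s)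
  have hlamm : ∀ s, lam F z s ≤ lam F z (s + 1) := fun s =>
    Real.log_le_log (RR_pos _ _ _) (RR_mono _ _ _)
  -- (A)
  set C6 := max 2 (Real.exp ((1 + C) / 8 + 2 * K ^ 2)) with hC6
  have hC6p : 0 < C6 := lt_of_lt_of_le (by norm_num) (le_max_left _ _)
  have hA : ∀ s : ℕ, sg F z s ^ 2 ≤ C6 * ((s:ℝ) + 2) ^ (1 / 4 : ℝ) := by
    intro s
    have hs0 : (0:ℝ) ≤ s := Nat.cast_nonneg _
    have hone : 1 ≤ ((s:ℝ) + 2) ^ (1 / 4 : ℝ) := Real.one_le_rpow (by linarith) (by norm_num)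
    rw [sg_sq_exp]
    rcases hd s with h | h
    · calc _ ≤ Real.exp (Real.log 2) := Real.exp_le_exp.2 (by linarith)
        _ = 2 * 1 := by rw [Real.exp_log (by norm_num)]; ring
        _ ≤ _ := mul_le_mul (le_max_left _ _) hone (by norm_num) hC6p.le
    · have hlog : 0 ≤ Real.log ((s:ℝ) + 1) := Real.log_nonneg (by linarith)
      have hX : 0 ≤ 1 + C + 2 * Real.log ((s:ℝ) + 1) := by positivity
      have hsq := Real.sq_sqrt hX
      set q := √(1 + C + 2 * Real.log ((s:ℝ) + 1))
      have hl : Real.log ((s:ℝ) + 1) ≤ Real.log ((s:ℝ) + 2) :=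
        Real.log_le_log (by linarith) (by linarith)
      have : lam F z (s + 1) - lam F z s ≤
          ((1 + C) / 8 + 2 * K ^ 2) + Real.log ((s:ℝ) + 2) * (1 / 4) := by
        have := hlam0 s
        nlinarith [sq_nonneg (q - 4 * K)]
      refine (Real.exp_le_exp.2 this).trans ?_
      rw [Real.exp_add, Real.exp_mul, Real.exp_log (by linarith)]
      exact mul_le_mul_of_nonneg_right (le_max_right _ _) (by positivity)
  -- (B)
  have hB : ∀ s : ℕ, ee F z (s + 1) ^ 2 ≤ (C + 16) ^ 2 * ((s:ℝ) + 2) ^ (1 / 4 : ℝ) := by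
    intro s
    have hs0 : (0:ℝ) ≤ s := Nat.cast_nonneg _
    have hone : 1 ≤ ((s:ℝ) + 2) ^ (1 / 8 : ℝ) := Real.one_le_rpow (by linarith) (by norm_num)
    have h3 := he (s + 1)
    have h4 := Real.log_le_rpow_div (x := (s:ℝ) + 2) (by linarith) (by norm_num : (0:ℝ) < 1 / 8)
    push_cast at h3
    rw [add_assoc, one_add_one_eq_two] at h3
    have h5 : |ee F z (s + 1)| ≤ (C + 16) * ((s:ℝ) + 2) ^ (1 / 8 : ℝ) := by
      have : ((s:ℝ) + 2) ^ (1 / 8 : ℝ) / (1 / 8) = 8 * ((s:ℝ) + 2) ^ (1 / 8 : ℝ) := by ring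
      rw [this] at h4
      nlinarith
    rw [← sq_abs]
    refine (pow_le_pow_left₀ (abs_nonneg _) h5 2).trans (le_of_eq ?_)
    rw [mul_pow, ← Real.rpow_natCast (((s:ℝ) + 2) ^ (1 / 8 : ℝ)), ← Real.rpow_mul (by linarith)]
    norm_num
  -- (C)
  set C8 := C6 * (C + 16) ^ 2 with hC8
  have hC8p : 0 < C8 := by positivity
  have hz : ∀ s : ℕ, z (s + 1) ^ 2 ≤ C8 * √((s:ℝ) + 2) := by
    intro s
    have hs0 : (0:ℝ) ≤ s := Nat.cast_nonneg _
    rw [z_eq F z s, mul_pow]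
    refine (mul_le_mul (hA s) (hB s) (sq_nonneg _) (by positivity)).trans (le_of_eq ?_)
    have : √((s:ℝ) + 2) = ((s:ℝ) + 2) ^ (1 / 4 : ℝ) * ((s:ℝ) + 2) ^ (1 / 4 : ℝ) := by
      rw [← Real.rpow_add (by linarith), Real.sqrt_eq_rpow]; norm_num
    rw [this, hC8]; ring
  have hsqle : ∀ s : ℕ, 1 ≤ √((s:ℝ) + 2) ∧ √((s:ℝ) + 2) ≤ (s:ℝ) + 2 := by
    intro s
    have hs0 : (0:ℝ) ≤ s := Nat.cast_nonneg _
    have h1 : 1 ≤ √((s:ℝ) + 2) := by rw [Real.le_sqrt' one_pos]; linarith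
    refine ⟨h1, ?_⟩
    nlinarith [Real.sq_sqrt (by linarith : 0 ≤ (s:ℝ) + 2)]
  -- (D)
  set C9 := 1 + C8 + |z 0| with hC9
  have hC9p : 0 < C9 := by positivity
  have hzi : ∀ i : ℕ, |z i| ≤ C9 * ((i:ℝ) + 2) := by
    intro i
    cases i with
    | zero =>
      have := abs_nonneg (z 0)
      push_cast; nlinarith
    | succ s =>
      have h2 := hz s
      have h3 := (hsqle s).2
      have hs0 : (0:ℝ) ≤ s := Nat.cast_nonneg _
      have h4 : |z (s + 1)| ≤ 1 + z (s + 1) ^ 2 := by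
        rw [← sq_abs]; nlinarith [sq_nonneg (|z (s + 1)| - 1), abs_nonneg (z (s + 1))]
      have h5 : C8 * √((s:ℝ) + 2) ≤ C8 * ((s:ℝ) + 2) := mul_le_mul_of_nonneg_left h3 hC8p.le
      have h6 : 0 ≤ |z 0| * ((s:ℝ) + 3) := by positivity
      push_cast
      rw [hC9]
      nlinarith
  -- (E)
  set C12 := Real.log 2 + 2 * Real.log C0 + (1 + 2 * a) * (Real.log (1 + C9) + 2) with hC12
  have hlC0 : 0 ≤ Real.log C0 := Real.log_nonneg hC0
  have hlC9 : 0 ≤ Real.log (1 + C9) := Real.log_nonneg (by linarith)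
  have hC12p : 0 ≤ C12 := by positivity
  have hE : ∀ t : ℕ, lam F z t ≤ C12 * √((t:ℝ) + 2) := by
    intro t
    have ht0 : (0:ℝ) ≤ t := Nat.cast_nonneg _
    set Y := (1 + C9) * ((t:ℝ) + 2) with hY
    have hY1 : 1 ≤ Y := by rw [hY]; nlinarith
    have htY : (t:ℝ) ≤ Y := by rw [hY]; nlinarith
    have hYa : 1 ≤ Y ^ a := Real.one_le_rpow hY1 ha
    have hFi : ∀ i ∈ Finset.range t, F (z i) ^ 2 ≤ (C0 * Y ^ a) ^ 2 := by
      intro i hi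
      have hit : (i:ℝ) ≤ t := by exact_mod_cast (Finset.mem_range.1 hi).le
      rw [← sq_abs]
      apply pow_le_pow_left₀ (abs_nonneg _)
      refine (h1 _).trans ?_
      apply mul_le_mul_of_nonneg_left _ (by linarith)
      apply Real.rpow_le_rpow (by positivity) _ ha
      have := hzi i
      have h3 : C9 * ((i:ℝ) + 2) ≤ C9 * ((t:ℝ) + 2) := by gcongr
      rw [hY]; nlinarith
    have hR : RR F z t ≤ 2 * (Y * (C0 * Y ^ a) ^ 2) := by
      unfold RR
      have h2 := Finset.sum_le_sum hFi
      rw [Finset.sum_const, Finset.card_range, nsmul_eq_mul] at h2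
      have h3 : 1 ≤ (C0 * Y ^ a) ^ 2 := by
        apply one_le_pow₀; nlinarith
      have h4 : (t:ℝ) * (C0 * Y ^ a) ^ 2 ≤ Y * (C0 * Y ^ a) ^ 2 := by gcongr
      have h5 : 1 ≤ Y * (C0 * Y ^ a) ^ 2 := by nlinarith
      linarith
    have h3 := Real.log_le_log (RR_pos F z t) hR
    have hYp : 0 < Y := by linarith
    rw [Real.log_mul (by norm_num) (by positivity), Real.log_mul hYp.ne' (by positivity),
      Real.log_pow, Real.log_mul (x := C0) (y := Y ^ a) (by positivity) (by positivity),
      Real.log_rpow hYp] at h3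
    have hlY : Real.log Y ≤ (Real.log (1 + C9) + 2) * √((t:ℝ) + 2) := by
      rw [hY, Real.log_mul (by positivity) (by positivity)]
      have e2 : Real.log ((t:ℝ) + 2) ≤ 2 * √((t:ℝ) + 2) := by
        have : Real.log ((t:ℝ) + 2) = 2 * Real.log (√((t:ℝ) + 2)) := by
          rw [Real.log_sqrt (by linarith)]; ring
        rw [this]
        have := Real.log_le_sub_one_of_pos (lt_of_lt_of_le one_pos (hsqle t).1)
        linarith
      nlinarith [(hsqle t).1]
    have hs1 := (hsqle t).1
    change lam F z t ≤ _ at h3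
    push_cast at h3
    have h6 := mul_le_mul_of_nonneg_left hlY (by linarith : 0 ≤ 1 + 2 * a)
    have h7 : Real.log 2 + 2 * Real.log C0 ≤ (Real.log 2 + 2 * Real.log C0) * √((t:ℝ) + 2) := by
      nlinarith
    rw [hC12]
    nlinarith
  -- (F)
  refine ⟨2 * C' + C12 / Real.log 2 * C8 * 3, fun t ht => ?_⟩
  have ht' : (1:ℝ) ≤ t := by exact_mod_cast ht
  rw [div_le_iff₀ (by linarith)]
  have hre : ∑ i ∈ Finset.Icc 1 t, (z i) ^ 2 = ∑ s ∈ Finset.range t, z (s + 1) ^ 2 := by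
    rw [Finset.range_eq_Ico, Finset.sum_Ico_add' (fun i => z i ^ 2) 0 t 1]
    rfl
  rw [hre]
  have hterm : ∀ s ∈ Finset.range t, z (s + 1) ^ 2 ≤ 2 * ee F z (s + 1) ^ 2 +
      (lam F z (s + 1) - lam F z s) * (C8 * √((t:ℝ) + 2) / Real.log 2) := by
    intro s hs
    have hst : (s:ℝ) ≤ t := by exact_mod_cast (Finset.mem_range.1 hs).le
    have hq : 0 ≤ C8 * √((t:ℝ) + 2) / Real.log 2 := by positivity
    have hdl : 0 ≤ lam F z (s + 1) - lam F z s := by linarith [hlamm s]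
    by_cases h : lam F z (s + 1) - lam F z s ≤ Real.log 2
    · have h2 : sg F z s ^ 2 ≤ 2 := by
        rw [sg_sq_exp]
        refine (Real.exp_le_exp.2 h).trans (le_of_eq (Real.exp_log (by norm_num)))
      have h3 : z (s + 1) ^ 2 ≤ 2 * ee F z (s + 1) ^ 2 := by
        rw [z_eq F z s, mul_pow]
        exact mul_le_mul_of_nonneg_right h2 (sq_nonneg _)
      have := mul_nonneg hdl hq
      linarith
    · push Not at h
      have h2 := hz s
      have h3 : C8 * √((s:ℝ) + 2) ≤ C8 * √((t:ℝ) + 2) := by gcongr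
      have h4 : C8 * √((t:ℝ) + 2) ≤
          (lam F z (s + 1) - lam F z s) * (C8 * √((t:ℝ) + 2) / Real.log 2) := by
        calc _ = Real.log 2 * (C8 * √((t:ℝ) + 2) / Real.log 2) := by field_simp
          _ ≤ _ := mul_le_mul_of_nonneg_right h.le hq
      have := sq_nonneg (ee F z (s + 1))
      linarith
  refine (Finset.sum_le_sum hterm).trans ?_
  rw [Finset.sum_add_distrib, ← Finset.mul_sum, ← Finset.sum_mul, Finset.sum_range_sub]
  have hl0 : lam F z 0 = 0 := by simp [lam, RR_zero]
  rw [hl0, sub_zero]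
  have h2 := hsl t
  have h3 := hE t
  have hq : 0 ≤ C8 * √((t:ℝ) + 2) / Real.log 2 := by positivity
  have h4 : lam F z t * (C8 * √((t:ℝ) + 2) / Real.log 2) ≤ C12 / Real.log 2 * C8 * ((t:ℝ) + 2) := by
    refine (mul_le_mul_of_nonneg_right h3 hq).trans (le_of_eq ?_)
    have h5 := Real.mul_self_sqrt (by linarith : 0 ≤ (t:ℝ) + 2)
    calc _ = C12 / Real.log 2 * C8 * (√((t:ℝ) + 2) * √((t:ℝ) + 2)) := by ring
      _ = _ := by rw [h5]
  have h6 : C12 / Real.log 2 * C8 * ((t:ℝ) + 2) ≤ C12 / Real.log 2 * C8 * (3 * t) := by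
    apply mul_le_mul_of_nonneg_left (by linarith) (by positivity)
  nlinarith

end Stab

end

-- part E
noncomputable section
namespace Stab

lemma mu_facts {a : ℝ} (ha : 4 ≤ a) :
    ∃ μ l : ℝ, 1 + (a - 2 - √((a - 2) ^ 2 - 4)) / 2 = μ ∧ μ + l = a ∧ μ * l = a ∧
      1 < μ ∧ μ ≤ 2 ∧ 2 ≤ l := by
  have h0 : 0 ≤ (a - 2) ^ 2 - 4 := by nlinarith
  have hs := Real.sq_sqrt h0
  have hn := Real.sqrt_nonneg ((a - 2) ^ 2 - 4)
  set q := √((a - 2) ^ 2 - 4)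
  refine ⟨_, a - (1 + (a - 2 - q) / 2), rfl, by ring, by nlinarith, ?_, ?_, ?_⟩
  · have : q < a - 2 := by nlinarith
    linarith
  · have : a - 4 ≤ q := by
      by_contra h
      push Not at h
      nlinarith
    linarith
  · linarith

set_option maxHeartbeats 2000000 in
lemma consts {a b C0 c1 σ0 : ℝ} (ha : 4 ≤ a) (hb : 0 ≤ b)
    (hb2 : b < (1 + (a - 2 - √((a - 2) ^ 2 - 4)) / 2) ^ 2) (hc1 : 0 < c1) :
    ∃ (c : Cst) (α K : ℝ), c.a = a ∧ c.b = b ∧ b ≤ a ∧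
      Real.log 2 + 2 * Real.log C0 ≤ c.δ * c.Λs ∧ 0 < α ∧ α ≤ 1 ∧
      α * (2 * Real.log (c.a + 1)) ≤ c1 ∧
      Real.log σ0 ≤ (c.ρ₀ - 1) * c.Λs / 2 ∧ 0 ≤ K ∧
      K + (2 / c.η) ^ α ≤ K * c.ρ₀ ^ (α / 2) ∧
      c.η * (2 * c.a * (c.a / c.δ + 1)) * (1 + Real.log (c.a + 1)) ≤ 1 / 2 := by
  obtain ⟨μ, l, hμ, hsum, hprod, h1, h2, h3⟩ := mu_facts ha
  rw [hμ] at hb2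
  have hba : b ≤ a := by nlinarith
  -- choice of ε
  obtain ⟨ε, hε, hε1, hε2, hε3⟩ : ∃ ε : ℝ, 0 < ε ∧ ε ≤ (μ - 1) / 3 ∧ ε ≤ 1 / 2 ∧
      ε * (b + 3) ≤ μ - b / μ := by
    have h : 0 < μ - b / μ := by
      rw [sub_pos, div_lt_iff₀ (by linarith)]; nlinarith
    refine ⟨min (min ((μ - 1) / 3) (1 / 2)) ((μ - b / μ) / (b + 3)), ?_, ?_, ?_, ?_⟩
    · refine lt_min (lt_min (by linarith) (by norm_num)) (by positivity)
    · exact (min_le_left _ _).trans (min_le_left _ _)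
    · exact (min_le_left _ _).trans (min_le_right _ _)
    · rw [← le_div_iff₀ (by linarith)]; exact min_le_right _ _
  set δ := ε ^ 2 / (2 * (a + 1)) with hδ
  have hδp : 0 < δ := by positivity
  have hδe : δ * (2 * (a + 1)) = ε ^ 2 := by rw [hδ]; field_simp
  have hδle : δ * 10 ≤ ε := by nlinarith
  have hlo : ∀ ρ, 1 ≤ ρ → ρ ≤ μ - ε → a * (1 - 1 / ρ) + δ ≤ ρ - δ := by
    intro ρ hρ1 hρ2
    have hρ : 0 < ρ := by linarith
    have e : ρ - δ - (a * (1 - 1 / ρ) + δ) = (ρ ^ 2 - a * ρ + a - 2 * δ * ρ) / ρ := by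
      field_simp; ring
    have : 0 ≤ (ρ ^ 2 - a * ρ + a - 2 * δ * ρ) / ρ := by
      apply div_nonneg _ hρ.le
      have h5 : ε * ε ≤ (μ - ρ) * (l - ρ) :=
        mul_le_mul (by linarith) (by linarith) hε.le (by linarith)
      have h6 : (μ - ρ) * (l - ρ) = ρ ^ 2 - a * ρ + a := by
        rw [← hsum]; linear_combination hprod - (hsum)
      have : δ * ρ ≤ δ * (a + 1) := by
        apply mul_le_mul_of_nonneg_left _ hδp.le; linarith
      nlinarith
    linarith
  have hhi : ∀ ρ, l + ε ≤ ρ → a * (1 - 1 / ρ) + δ ≤ ρ - δ := by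
    intro ρ hρ2
    have hρ : 0 < ρ := by linarith
    have e : ρ - δ - (a * (1 - 1 / ρ) + δ) = (ρ ^ 2 - a * ρ + a - 2 * δ * ρ) / ρ := by
      field_simp; ring
    have : 0 ≤ (ρ ^ 2 - a * ρ + a - 2 * δ * ρ) / ρ := by
      apply div_nonneg _ hρ.le
      have h6 : (μ - ρ) * (l - ρ) = ρ ^ 2 - a * ρ + a := by
        rw [← hsum]; linear_combination hprod - (hsum)
      have h5 : ε * (ρ - μ) ≤ (μ - ρ) * (l - ρ) := by nlinarith
      -- (ρ - μ) (l + ε) ≥ ε ρ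
      have h7 : ε * ρ ≤ (ρ - μ) * (a + 1) := by
        have h8 : ε * ρ ≤ (ρ - μ) * (l + ε) := by nlinarith
        have h9 : (ρ - μ) * (l + ε) ≤ (ρ - μ) * (a + 1) :=
          mul_le_mul_of_nonneg_left (by linarith) (by linarith)
        linarith
      have h10 : 2 * δ * ρ * (a + 1) ≤ ε * (ρ - μ) * (a + 1) := by nlinarith
      have h11 := le_of_mul_le_mul_right h10 (by linarith)
      linarith
    linarith
  have hhit : b * (1 - 1 / (l + ε)) + δ < μ - ε := by
    have e1 : 1 / (l + ε) = 1 / l - ε / (l * (l + ε)) := by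
      field_simp; ring
    have e2 : 1 - 1 / l = 1 / μ := by
      field_simp; linarith
    have e3 : ε / (l * (l + ε)) ≤ ε := by
      rw [div_le_iff₀ (by positivity)]
      have : 1 ≤ l * (l + ε) := by nlinarith
      nlinarith
    have e4 : b * (ε / (l * (l + ε))) ≤ b * ε := mul_le_mul_of_nonneg_left e3 hb
    have e5 : b * (1 - 1 / (l + ε)) = b / μ + b * (ε / (l * (l + ε))) := by
      rw [e1, show 1 - (1 / l - ε / (l * (l + ε))) = (1 - 1 / l) + ε / (l * (l + ε)) by ring, e2]
      ring
    nlinarith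
  obtain ⟨n, hn⟩ := exists_nat_ge ((a + 1) / δ)
  rw [div_le_iff₀ hδp] at hn
  have hla : 0 < Real.log (a + 1) := Real.log_pos (by linarith)
  set D := 2 * a * (a / δ + 1) * (1 + Real.log (a + 1)) with hD
  have hDp : 0 < D := by positivity
  set η := 1 / (2 * D) with hη
  have hηp : 0 < η := by positivity
  set α := min 1 (c1 / (2 * Real.log (a + 1))) with hα
  have hαp : 0 < α := lt_min one_pos (by positivity)
  have hρ0 : 1 < μ - ε := by linarith
  have hr1 : 1 < (μ - ε) ^ (α / 2) := Real.one_lt_rpow hρ0 (by linarith)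
  obtain ⟨Λs, g1, g2, g3, g4, g5, g6⟩ : ∃ Λs : ℝ, ((n + 2 : ℕ) : ℝ) ^ 2 ≤ Λs ∧ 2 * a ≤ Λs ∧
      μ - ε ≤ Λs ∧ Real.log 2 / δ ≤ Λs ∧ (Real.log 2 + 2 * Real.log C0) / δ ≤ Λs ∧
      2 * Real.log σ0 / (μ - ε - 1) ≤ Λs := by
    obtain ⟨B, hB⟩ := ({((n + 2 : ℕ) : ℝ) ^ 2, 2 * a, μ - ε, Real.log 2 / δ,
      (Real.log 2 + 2 * Real.log C0) / δ, 2 * Real.log σ0 / (μ - ε - 1)} : Finset ℝ).bddAbove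
    exact ⟨B, hB (by simp), hB (by simp), hB (by simp), hB (by simp), hB (by simp), hB (by simp)⟩
  rw [div_le_iff₀ hδp] at g4 g5
  rw [div_le_iff₀ (by linarith)] at g6
  refine ⟨{ a := a, b := b, ρ₀ := μ - ε, ρ₁ := l + ε, δ := δ, κ := δ, Λs := Λs, η := η, N := n + 2,
            ha := ha, hb := hb, h0 := hρ0, hδ := hδp, hδ2 := by linarith, h0δ := by linarith,
            hκ := hδp, hρ1 := by linarith, hhi := hhi, hlo := hlo, hhit := hhit, hN2 := by omega,
            hN := by push_cast; linarith, hη := hηp, hΛN := g1, hΛa := g2, hΛρ := g3,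
            hΛ2 := by linarith }, α, (2 / η) ^ α / ((μ - ε) ^ (α / 2) - 1), rfl, rfl, hba, ?_, hαp,
            min_le_left _ _, ?_, ?_, ?_, ?_, ?_⟩
  · show _ ≤ δ * Λs
    linarith
  · show α * (2 * Real.log (a + 1)) ≤ c1
    rw [← le_div_iff₀ (by positivity)]
    exact min_le_right _ _
  · show _ ≤ (μ - ε - 1) * Λs / 2
    linarith
  · have : 0 < (μ - ε) ^ (α / 2) - 1 := by linarith
    positivity
  · show _ + (2 / η) ^ α ≤ _ * (μ - ε) ^ (α / 2)
    have : 0 < (μ - ε) ^ (α / 2) - 1 := by linarith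
    have e : (2 / η) ^ α / ((μ - ε) ^ (α / 2) - 1) * ((μ - ε) ^ (α / 2) - 1) = (2 / η) ^ α :=
      div_mul_cancel₀ _ this.ne'
    linarith
  · show η * (2 * a * (a / δ + 1)) * (1 + Real.log (a + 1)) ≤ 1 / 2
    have : η * (2 * a * (a / δ + 1)) * (1 + Real.log (a + 1)) = η * D := by rw [hD]; ring
    rw [this, hη]
    apply le_of_eq
    field_simp

variable {Ω : Type*} [MeasurableSpace Ω] {P : Measure Ω} [IsProbabilityMeasure P]

lemma normalize (θ : Ω → ℝ) (hθm : Measurable θ) (θ₀ : ℝ) (P₀ : NNReal) (hP₀ : 0 < P₀)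
    (h : Measure.map θ P = gaussianReal θ₀ P₀) :
    Measure.map (fun ω => (θ ω - θ₀) / √P₀) P = gaussianReal 0 1 := by
  have e : (fun ω => (θ ω - θ₀) / √P₀) = (fun x : ℝ => x / √P₀) ∘ (fun x => x - θ₀) ∘ θ := rfl
  rw [e, ← Measure.map_map (by fun_prop) (by fun_prop), ← Measure.map_map (by fun_prop) hθm, h,
    gaussianReal_map_sub_const, gaussianReal_map_div_const]
  congr 1
  · simp
  · apply NNReal.eq
    simp [hP₀.ne']

lemma growth {f : ℝ → ℝ} {a γ₁ γ₂ b L p : ℝ} (hp : 0 < p) (ha : 4 ≤ a) (hγ₁ : 0 < γ₁) (hγ₂ : 0 < γ₂)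
    (hfgrow : ∀ x : ℝ, |f x| ≤ γ₁ + γ₂ * |x| ^ a) (hL : 0 < L) :
    ∃ C0 : ℝ, 1 ≤ C0 ∧ (∀ x, |p * f x| ≤ C0 * (1 + |x|) ^ a) ∧
      ∀ x ∈ {x : ℝ | |f x| < L * |x| ^ b}, |p * f x| ≤ C0 * (1 + |x|) ^ (max b 0) := by
  set C0 := max 1 (max (p * (γ₁ + γ₂)) (p * L)) with hC0
  have k1 : 1 ≤ C0 := le_max_left _ _
  have k2 : p * (γ₁ + γ₂) ≤ C0 := (le_max_left _ _).trans (le_max_right _ _)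
  have k3 : p * L ≤ C0 := (le_max_right _ _).trans (le_max_right _ _)
  refine ⟨C0, k1, fun x => ?_, fun x hx => ?_⟩
  · rw [abs_mul, abs_of_pos hp]
    have h0 := abs_nonneg x
    have h1 : |x| ^ a ≤ (1 + |x|) ^ a := Real.rpow_le_rpow h0 (by linarith) (by linarith)
    have h2 : 1 ≤ (1 + |x|) ^ a := Real.one_le_rpow (by linarith) (by linarith)
    calc p * |f x| ≤ p * (γ₁ + γ₂ * |x| ^ a) := mul_le_mul_of_nonneg_left (hfgrow x) hp.le
      _ ≤ p * ((γ₁ + γ₂) * (1 + |x|) ^ a) := by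
        apply mul_le_mul_of_nonneg_left _ hp.le
        nlinarith
      _ = p * (γ₁ + γ₂) * (1 + |x|) ^ a := by ring
      _ ≤ _ := by gcongr
  · rw [abs_mul, abs_of_pos hp]
    have h0 := abs_nonneg x
    have h2 : 1 ≤ (1 + |x|) ^ (max b 0) := Real.one_le_rpow (by linarith) (le_max_right _ _)
    rcases le_total |x| 1 with h | h
    · have h3 : |x| ^ a ≤ 1 := Real.rpow_le_one h0 h (by linarith)
      have h4 : p * |f x| ≤ p * (γ₁ + γ₂) :=
        mul_le_mul_of_nonneg_left ((hfgrow x).trans (by nlinarith)) hp.le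
      nlinarith
    · have h3 : |x| ^ b ≤ (1 + |x|) ^ (max b 0) :=
        (Real.rpow_le_rpow_of_exponent_le h (le_max_left _ _)).trans
          (Real.rpow_le_rpow h0 (by linarith) (le_max_right _ _))
      have h4 : |f x| ≤ L * |x| ^ b := le_of_lt hx
      calc p * |f x| ≤ p * (L * (1 + |x|) ^ (max b 0)) := by gcongr; exact h4.trans (by gcongr)
        _ = p * L * (1 + |x|) ^ (max b 0) := by ring
        _ ≤ _ := by gcongr

end Stab
end

theorem stmt_1
    {Ω : Type*} [MeasurableSpace Ω] (P : Measure Ω) [IsProbabilityMeasure P]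
    (f : ℝ → ℝ) (hf : Measurable f)
    (θ : Ω → ℝ) (hθm : Measurable θ)
    (w : ℕ → Ω → ℝ) (hwm : ∀ t, Measurable (w t))
    (θ₀ : ℝ) (P₀ : NNReal) (hP₀ : 0 < P₀)
    (hw_gauss : ∀ t : ℕ, Measure.map (w (t + 1)) P = gaussianReal 0 1)
    (hw_indep : iIndepFun (fun t : ℕ => w (t + 1)) P)
    (hθ_gauss : Measure.map θ P = gaussianReal θ₀ P₀)
    (hθw : IndepFun θ (fun ω (t : ℕ) => w (t + 1) ω) P)
    (a γ₁ γ₂ : ℝ) (ha : 4 ≤ a) (hγ₁ : 0 < γ₁) (hγ₂ : 0 < γ₂)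
    (hfgrow : ∀ x : ℝ, |f x| ≤ γ₁ + γ₂ * |x| ^ a)
    (b L : ℝ) (hL : 0 < L)
    (hb : b < (1 + (a - 2 - Real.sqrt ((a - 2) ^ 2 - 4)) / 2) ^ 2)
    (hliminf : (0 : EReal) < Filter.liminf (fun l : ℝ =>
      (((volume ({x : ℝ | |f x| < L * |x| ^ b} ∩ Set.Icc (-l) l)).toReal / l *
        Real.log (Real.log l) : ℝ) : EReal)) Filter.atTop) :
    ∃ g : (t : ℕ) → (Fin (t + 1) → ℝ) → ℝ, (∀ t, Measurable (g t)) ∧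
      ∀ y₀ : ℝ, ∀ y : ℕ → Ω → ℝ,
        (∀ ω, y 0 ω = y₀) →
        (∀ t ω, y (t + 1) ω =
          θ ω * f (y t ω) + g t (fun i => y i ω) + w (t + 1) ω) →
        ∀ᵐ ω ∂P, ∃ M : ℝ, ∀ t : ℕ, 1 ≤ t →
          (∑ i ∈ Finset.Icc 1 t, (y i ω) ^ 2) / t ≤ M := by
  classical
  have hp : 0 < √(P₀ : ℝ) := Real.sqrt_pos.2 (by exact_mod_cast hP₀)
  set p : ℝ := √(P₀ : ℝ) with hpdef
  have hF : Measurable (fun x => p * f x) := hf.const_mul p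
  refine ⟨Stab.ctrl f (fun x => p * f x) θ₀ p, fun t => Stab.meas_ctrl hf hF θ₀ p t, ?_⟩
  intro y₀ y hy0 hy
  have hS : MeasurableSet {x : ℝ | |f x| < L * |x| ^ b} :=
    measurableSet_lt (by fun_prop) (by fun_prop)
  obtain ⟨C0, hC0, hg1, hg2⟩ := Stab.growth (b := b) hp ha hγ₁ hγ₂ hfgrow hL
  obtain ⟨c1, σ0, hc1, hσ0, hHP⟩ := Stab.hitProb_of_liminf hS hliminf
  have hb' : max b 0 < (1 + (a - 2 - Real.sqrt ((a - 2) ^ 2 - 4)) / 2) ^ 2 := by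
    refine max_lt hb ?_
    obtain ⟨μ, l, hμ, -, -, h1, -⟩ := Stab.mu_facts ha
    rw [hμ]; positivity
  obtain ⟨c, α, K, hca, hcb, hba, q1, q2, q3, q4, q5, q6, q7, q8⟩ :=
    Stab.consts (C0 := C0) (σ0 := σ0) ha (le_max_right b 0) hb' hc1
  obtain ⟨e, he1, he2, he3, he4, he5⟩ := Stab.innovations f (fun x => p * f x) hf θ hθm w hwm θ₀ p hp
    (fun _ => rfl) hF hw_gauss hw_indep (Stab.normalize θ hθm θ₀ P₀ hP₀ hθ_gauss) hθw y₀ y hy0 hy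
  have hee : ∀ t, (fun ω => Stab.ee (fun x => p * f x) (fun i => y i ω) (t + 1)) = e (t + 1) := by
    intro t
    funext ω
    have h := Stab.sg_ge (fun x => p * f x) (fun i => y i ω) t
    simp only [Stab.ee]
    rw [div_eq_iff (by linarith), mul_comm]
    exact he5 t ω
  have M : Stab.Model P (fun x => p * f x) y₀ y :=
    ⟨hF, hy0, he2, fun t => by rw [hee]; exact he3 t, fun t => by rw [hee]; exact he4 t⟩
  have hpath : ∀ z, Stab.Path c (Stab.lam (fun x => p * f x) z) (Stab.EE c (fun x => p * f x) z)
      (Stab.Hit (fun x => p * f x) {x : ℝ | |f x| < L * |x| ^ b} z) := fun z =>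
    Stab.path_lam c _ _ z hC0 (by rw [hca, hcb]; exact hba) (by rw [hca]; exact hg1)
      (by rw [hcb]; exact hg2) q1
  filter_upwards [Stab.bounded_cash M hpath hS hHP q2 q3 q4 hσ0 q5 q6 q7, M.log_bound, M.slln] with
    ω ⟨m, hm⟩ ⟨C, hC, hlb⟩ ⟨C', hC', hsl⟩
  have hlog0 : ∀ s : ℕ, 0 ≤ Real.log ((s:ℝ) + 1) := fun s =>
    Real.log_nonneg (by linarith [Nat.cast_nonneg (α := ℝ) s])
  obtain ⟨K', hK'⟩ := Stab.dbl_or_slow (hpath (fun i => y i ω)) hm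
    (X := fun s : ℕ => 1 + C + 2 * Real.log ((s:ℝ) + 1))
    (fun s => by have := hlog0 s; linarith)
    (by
      intro s t hst
      have : Real.log ((s:ℝ) + 1) ≤ Real.log ((t:ℝ) + 1) := by
        apply Real.log_le_log (by positivity)
        have : (s:ℝ) ≤ t := by exact_mod_cast hst
        linarith
      simp only; linarith)
    (by
      intro s
      unfold Stab.EE
      have h1 : Real.log (1 + |Stab.ee (fun x => p * f x) (fun i => y i ω) s|) ≤
          Real.log (1 + C + 2 * Real.log ((s:ℝ) + 1)) := by
        apply Real.log_le_log (by positivity)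
        have := hlb s
        linarith
      have := c.ha
      have := mul_le_mul_of_nonneg_left h1 (by linarith : 0 ≤ 2 * c.a)
      linarith)
    q8
  exact Stab.finish (by linarith) hC0 hg1 hC hC' hlb hsl hK'
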